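/- Every 3-connected K_{2,4}-minor-free graph has a hamilton cycle. -/

import Mathlib

namespace K24Paper

open SimpleGraph

/-- `H` is a minor of `G`: branch sets indexed by vertices of `H`, pairwise disjoint,
each inducing a connected subgraph of `G`, with every edge of `H` realized by an edge
of `G` between the corresponding branch sets. -/
def IsMinor {W V : Type*} (H : SimpleGraph W) (G : SimpleGraph V) : Prop :=
  ∃ B : W → Set V,
    (∀ w, (G.induce (B w)).Connected) ∧
    (∀ w₁ w₂, w₁ ≠ w₂ → Disjoint (B w₁) (B w₂)) ∧
    (∀ w₁ w₂, H.Adj w₁ w₂ → ∃ v₁ ∈ B w₁, ∃ v₂ ∈ B w₂, G.Adj v₁ v₂)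

/-- `G` is `H`-minor-free. -/
def MinorFree {W V : Type*} (H : SimpleGraph W) (G : SimpleGraph V) : Prop :=
  ¬ IsMinor H G

/-- The complete bipartite graph `K_{2,4}`. -/
def K24 : SimpleGraph (Fin 2 ⊕ Fin 4) := completeBipartiteGraph (Fin 2) (Fin 4)

/-- `G` is `k`-connected: more than `k` vertices, and removing fewer than `k`
vertices leaves a connected graph. -/
def KConnected {V : Type*} (k : ℕ) (G : SimpleGraph V) : Prop :=
  k < Nat.card V ∧ ∀ S : Set V, S.ncard < k → (G.induce Sᶜ).Connected

/-- The graph `G_{n,r,s}` (with the plus edge if `plus = true`), on vertices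
`0, …, n-1` corresponding to `v_1, …, v_n`:  the spine `v_1 v_2 ⋯ v_n`, the edges
`v_1 v_{n-i}` for `1 ≤ i ≤ r`, the edges `v_n v_{1+j}` for `1 ≤ j ≤ s`, and
(if `plus`) the plus edge `v_1 v_n`. -/
def Gnrs (n r s : ℕ) (plus : Bool) : SimpleGraph (Fin n) :=
  SimpleGraph.fromRel (fun a b =>
    b.val = a.val + 1 ∨
    (a.val = 0 ∧ n - 1 - r ≤ b.val ∧ b.val ≤ n - 2) ∨
    (b.val = n - 1 ∧ 1 ≤ a.val ∧ a.val ≤ s) ∨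
    (plus = true ∧ a.val = 0 ∧ b.val = n - 1))

/-- The parameter conditions describing membership in the class `𝒢`. -/
def Gparams (n r s : ℕ) (plus : Bool) : Prop :=
  (plus = true ∧ 4 ≤ n ∧ ((r = 1 ∧ s = n - 3) ∨ (r = n - 3 ∧ s = 1))) ∨
  (5 ≤ n ∧ 2 ≤ r ∧ r ≤ n - 3 ∧ 2 ≤ s ∧ s ≤ n - 3 ∧ (r + s = n - 2 ∨ r + s = n - 1))

/-- `G` belongs to `𝒢̃`, i.e. `G` is isomorphic to a graph of the class `𝒢`. -/
def InGtilde {V : Type*} (G : SimpleGraph V) : Prop :=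
  ∃ n r s plus, Gparams n r s plus ∧ Nonempty (G ≃g Gnrs n r s plus)

/-- The graph obtained from `G` by subdividing every edge in `F` once:
new vertices are the members of `F`. -/
def SubdivideEdges {V : Type*} (G : SimpleGraph V) (F : Set (Sym2 V)) :
    SimpleGraph (V ⊕ F) :=
  SimpleGraph.fromRel (fun a b =>
    match a, b with
    | Sum.inl u, Sum.inl v => G.Adj u v ∧ s(u, v) ∉ F
    | Sum.inl u, Sum.inr e => u ∈ (e : Sym2 V)
    | Sum.inr e, Sum.inl u => u ∈ (e : Sym2 V)
    | Sum.inr _, Sum.inr _ => False)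

/-- A set `F` of edges of a graph `G` is subdividable if subdividing every edge
of `F` once yields a `K_{2,4}`-minor-free graph. -/
def Subdividable {V : Type*} (G : SimpleGraph V) (F : Set (Sym2 V)) : Prop :=
  F ⊆ G.edgeSet ∧ MinorFree K24 (SubdivideEdges G F)

/-- `F` is a maximal subdividable set of edges of `G`. -/
def MaxSubdividable {V : Type*} (G : SimpleGraph V) (F : Set (Sym2 V)) : Prop :=
  Subdividable G F ∧ ∀ F', Subdividable G F' → F ⊆ F' → F' = F

/-- `l` lists vertices along a path of `G` (consecutive entries adjacent, no repeats)
such that no two edges of `G` cross with respect to this ordering. -/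
def OuterListing {U : Type*} (G : SimpleGraph U) (l : List U) : Prop :=
  l.Nodup ∧ l.Chain' G.Adj ∧
  ∀ (i k j m : ℕ) (h1 : i < k) (h2 : k < j) (h3 : j < m) (hm : m < l.length),
    ¬(G.Adj (l.get ⟨i, by omega⟩) (l.get ⟨j, by omega⟩) ∧
      G.Adj (l.get ⟨k, by omega⟩) (l.get ⟨m, by omega⟩))

/-- The graph `G` restricted to the vertex set `A` is `xy`-outerplanar: it has a
hamilton `xy`-path (listing exactly the vertices of `A`) such that no two edges
cross with respect to it. -/
def XYOuterplanar {U : Type*} (G : SimpleGraph U) (A : Set U) (x y : U) : Prop :=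
  ∃ l : List U, (∀ v, v ∈ l ↔ v ∈ A) ∧ l.head? = some x ∧ l.getLast? = some y ∧
    OuterListing G l

/-- A block: a connected graph with no cutvertex. -/
def IsBlock {V : Type*} (G : SimpleGraph V) : Prop :=
  G.Connected ∧ ∀ v : V, (G.induce {u | u ≠ v}).Preconnected

/-- `G + xy`: the graph `G` with the edge `xy` added (if not already present). -/
def AddEdge {U : Type*} (G : SimpleGraph U) (x y : U) : SimpleGraph U :=
  G ⊔ SimpleGraph.fromRel (fun a b => a = x ∧ b = y)

/-- A standard `K_{2,t}` minor `(R₁, R₂; S)` of `G`. -/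
def StdK2tMinor {V : Type*} (G : SimpleGraph V) (t : ℕ) (R₁ R₂ S : Set V) : Prop :=
  Disjoint R₁ R₂ ∧ Disjoint (R₁ ∪ R₂) S ∧
  (G.induce R₁).Connected ∧ (G.induce R₂).Connected ∧
  S.Finite ∧ S.ncard = t ∧
  ∀ v ∈ S, (∃ w ∈ R₁, G.Adj v w) ∧ (∃ w ∈ R₂, G.Adj v w)

/-- `K_{3,3}` with parts `{0,1,2}` and `{3,4,5}`. -/
def K33 : SimpleGraph (Fin 6) :=
  SimpleGraph.fromRel (fun a b => a.val < 3 ∧ 3 ≤ b.val)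

/-- The graph `A = K_{3,3} + v₂v₃`. -/
def GA : SimpleGraph (Fin 6) := AddEdge K33 1 2

/-- The graph `A⁺ = K_{3,3} + v₂v₃ + v₅v₆`. -/
def GAplus : SimpleGraph (Fin 6) := AddEdge GA 4 5

/-- The graph `B`, on vertices `h, r₁, r₂, r₃, r₄, g₁, g₂ = 0, …, 6`. -/
def GB : SimpleGraph (Fin 7) :=
  SimpleGraph.fromRel (fun a b => (a.val, b.val) ∈
    [(0,3),(0,4),(1,4),(2,3),(3,4),(5,0),(5,1),(5,2),(6,0),(6,1),(6,2)])

/-- The graph `B⁺ = B + g₁g₂`. -/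
def GBplus : SimpleGraph (Fin 7) := AddEdge GB 5 6

/-- The graph `C⁺`, on vertices `v₁, …, v₈ = 0, …, 7`. -/
def GCplus : SimpleGraph (Fin 8) :=
  SimpleGraph.fromRel (fun a b => (a.val, b.val) ∈
    [(0,1),(0,2),(1,2),(3,4),(3,5),(3,6),(3,7),(4,5),(4,6),(4,7),(2,5),(1,7),(0,6)])

/-- The graph `C = C⁺ ∖ v₄v₅`. -/
def GC : SimpleGraph (Fin 8) := GCplus.deleteEdges {s(3, 4)}

/-- The graph `D`, on vertices `t₁, t₂, t₃, d₁, d₂, d₃, g = 0, …, 6`. -/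
def GD : SimpleGraph (Fin 7) :=
  SimpleGraph.fromRel (fun a b => (a.val, b.val) ∈
    [(0,1),(0,2),(1,2),(3,4),(3,5),(4,5),(0,3),(1,4),(2,5),(6,0),(6,1),(6,2)])

/-- The complete graph `K₅`. -/
def GK5 : SimpleGraph (Fin 5) := completeGraph (Fin 5)

end K24Paper

namespace K24Paper

open SimpleGraph

/-! ### A small certificate checker -/

/-- Index of the unordered pair of labels `a, b`. -/
def vx (a b : ℕ) : ℕ := if a < b then 16 * a + b else 16 * b + a

/-- Bit mask of a list of pairs. -/
def maskOf : List (ℕ × ℕ) → ℕ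
  | [] => 0
  | p :: t => 2 ^ vx p.1 p.2 ||| maskOf t

/-- Certificates for clauses: a `K_{2,4}` minor using the chords `ch`, a hamilton cycle,
and a pair of vertices whose removal does not separate `comp` from the rest. -/
inductive Cert where
  | k (ch : List (ℕ × ℕ)) (r₁ r₂ s : List ℕ)
  | h (l : List ℕ)
  | c (a b : ℕ) (comp : List ℕ)

/-- The combinatorial data of a partition into blocks: number of blocks, the singleton blocks,
edges known to exist, edges known not to exist, joins of consecutive blocks. -/
structure Cfg where
  n : ℕ
  sg : List ℕ
  t0 : List (ℕ × ℕ)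
  f0 : List (ℕ × ℕ)
  jn : List (ℕ × ℕ)

/-- Membership of an unordered pair in a list. -/
def pmem (l : List (ℕ × ℕ)) (a b : ℕ) : Bool :=
  l.any fun q => (q.1 == a && q.2 == b) || (q.1 == b && q.2 == a)

/-- Every element is adjacent to a later one, except for the last one. -/
def okConn (adj : ℕ → ℕ → Bool) : List ℕ → Bool
  | [] => false
  | [_] => true
  | i :: j :: t => (j :: t).any (adj i) && okConn adj (j :: t)

/-- No repetitions. -/
def okNodup : List ℕ → Bool
  | [] => true
  | i :: t => !(t.elem i) && okNodup t

/-- The label of an oriented block. -/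
def lab (x : ℕ) : ℕ := if x < 20 then x else x - 20

/-- Both blocks are singletons. -/
def bothS (g : Cfg) (x y : ℕ) : Bool := g.sg.elem (lab x) && g.sg.elem (lab y)

/-- The oriented block `y` may follow the oriented block `x`. -/
def stepOK (g : Cfg) (x y : ℕ) : Bool :=
  bothS g x y ||
  ((decide (x < 20) || g.sg.elem (lab x)) && (decide (y < 20) || g.sg.elem (lab y)) &&
    g.jn.any fun q => q.1 == lab x && q.2 == lab y) ||
  ((decide (20 ≤ x) || g.sg.elem (lab x)) && (decide (20 ≤ y) || g.sg.elem (lab y)) &&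
    g.jn.any fun q => q.1 == lab y && q.2 == lab x)

/-- All consecutive steps are fine. -/
def okChain (g : Cfg) : List ℕ → Bool
  | x :: y :: t => stepOK g x y && okChain g (y :: t)
  | _ => true

/-- The edges needed by the steps. -/
def chEdges (g : Cfg) : List ℕ → List (ℕ × ℕ)
  | x :: y :: t => if bothS g x y then (lab x, lab y) :: chEdges g (y :: t)
      else chEdges g (y :: t)
  | _ => []

/-- The pairs between `comp` and the labels outside `comp`, `a` and `b`. -/
def crossing (n a b : ℕ) (comp : List ℕ) : List (ℕ × ℕ) :=
  comp.flatMap fun x => ((List.range n).filter fun y =>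
    !(comp.elem y) && !(y == a) && !(y == b)).map fun y => (x, y)

/-- Validity of a certificate. -/
def Cert.ok (g : Cfg) : Cert → Bool
  | .k ch r₁ r₂ s =>
    okConn (pmem (g.t0 ++ ch)) r₁ && okConn (pmem (g.t0 ++ ch)) r₂ &&
    (s.all fun x => r₁.any (pmem (g.t0 ++ ch) x) && r₂.any (pmem (g.t0 ++ ch) x)) &&
    (s.length == 4) && okNodup (r₁ ++ (r₂ ++ s)) &&
    (r₁ ++ (r₂ ++ s)).all fun x => decide (x < g.n)
  | .h l =>
    (l.head? == some 0) && g.sg.elem 0 &&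
    okNodup (l.map lab) && (l.length == g.n) && ((l.map lab).all fun x => decide (x < g.n)) &&
    okChain g (l ++ [0])
  | .c a b comp =>
    g.sg.elem a && g.sg.elem b && !(comp.elem a) && !(comp.elem b) && !(comp.isEmpty) &&
    (comp.all fun x => decide (x < g.n)) && decide (a < g.n) && decide (b < g.n) &&
    ((List.range g.n).any fun y => !(comp.elem y) && !(y == a) && !(y == b))

/-- The clause of a certificate: positive and negative literals. -/
def Cert.clause (g : Cfg) : Cert → ℕ × ℕ
  | .k ch _ _ _ => (0, maskOf ch)
  | .h l => (0, maskOf (chEdges g (l ++ [0])))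
  | .c a b comp => (maskOf (crossing g.n a b comp), 0)

/-- The result of looking at the list of clauses. -/
inductive Scan where
  | conflict
  | unit (p q : ℕ)
  | branch (k : ℕ)
  | none

/-- Look for a conflict or a unit clause. -/
def scan (T F : ℕ) : List (ℕ × ℕ) → Scan → Scan
  | [], d => d
  | (p, q) :: t, d =>
    if (p &&& T) ||| (q &&& F) != 0 then scan T F t d
    else
      let p' := p ^^^ (p &&& F)
      let q' := q ^^^ (q &&& T)
      if p' == 0 then
        if q' == 0 then .conflict
        else if q' == 2 ^ Nat.log2 q' then .unit 0 q'
        else scan T F t d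
      else if q' == 0 && p' == 2 ^ Nat.log2 p' then .unit p' 0
      else scan T F t (.branch (Nat.log2 p'))

/-- A naive DPLL procedure. -/
def dpll (cls : List (ℕ × ℕ)) : ℕ → ℕ → ℕ → Bool
  | 0, _, _ => false
  | f + 1, T, F =>
    match scan T F cls .none with
    | .conflict => true
    | .unit p q => dpll cls f (T ||| p) (F ||| q)
    | .branch k => dpll cls f (T ||| 2 ^ k) F && dpll cls f T (F ||| 2 ^ k)
    | .none => false

/-- The complete check. -/
def check (g : Cfg) (cs : List Cert) : Bool :=
  cs.all (fun c => c.ok g) &&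
    dpll (cs.map fun c => c.clause g) 200 (maskOf g.t0) (maskOf g.f0)

/-- Blocks of a segment of (truncated) length `s`, starting with label `i`:
the singleton labels. -/
def segSg (i s : ℕ) : List ℕ := if s = 3 then [i, i + 2] else if s = 2 then [i, i + 1] else [i]

/-- Cyclically consecutive labels. -/
def cyJn (n : ℕ) : List (ℕ × ℕ) := (n - 1, 1) :: (List.range (n - 2)).map fun i => (i + 1, i + 2)

/-- Configuration of three segments. -/
def cfg3 (a b c : ℕ) : Cfg :=
  let n := a + b + c + 4
  let us := [1, a + 2, a + b + 3]
  { n := n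
    sg := 0 :: us ++ segSg 2 a ++ segSg (a + 3) b ++ segSg (a + b + 4) c
    t0 := cyJn n ++ us.map fun u => (0, u)
    f0 := ((List.range n).filter fun y => !((0 :: us).elem y)).map fun y => (0, y)
    jn := cyJn n }

/-- Configuration of four contracted segments. -/
def cfg4 : Cfg :=
  { n := 9
    sg := [0, 1, 3, 5, 7]
    t0 := cyJn 9 ++ [(0, 1), (0, 3), (0, 5), (0, 7)]
    f0 := [(0, 2), (0, 4), (0, 6)]
    jn := cyJn 9 }

/-- Certificates for four neighbours. -/
def certs4 : List Cert :=
  [.c 1 3 [2],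
   .k [(2,8),(3,6)] [7,0] [4,3,2] [1,5,6,8],
   .k [(2,6)] [6,2] [0] [1,3,5,7],
   .k [(2,7),(3,6)] [5,0] [3,2] [1,4,6,7],
   .k [(2,5),(3,6)] [5] [3] [0,2,4,6],
   .k [(2,5),(4,6)] [7,6] [3,2,1] [0,4,5,8],
   .k [(2,5),(6,8)] [6,5] [3,1,0] [2,4,7,8],
   .k [(1,6),(2,5)] [6,5] [3,0] [1,2,4,7],
   .k [(2,8),(4,6)] [7,0] [4,3,2] [1,5,6,8],
   .k [(2,8),(6,8)] [8] [5,3,0] [1,2,6,7],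
   .k [(2,7),(4,6)] [7,6] [3,1,0] [2,4,5,8],
   .k [(2,7),(6,8)] [6,5] [3,2,1] [0,4,7,8],
   .k [(2,4),(4,6)] [6,4] [1,0] [2,3,5,7],
   .k [(2,4),(3,6)] [7,6] [4,2,1] [0,3,5,8],
   .k [(2,4),(6,8)] [6,5,4] [1,0] [2,3,7,8],
   .k [(1,6),(2,4)] [7,0] [4,2,1] [3,5,6,8],
   .k [(1,6),(2,7)] [7] [1] [0,2,6,8],
   .k [(1,6),(2,8)] [7,6] [4,3,2] [0,1,5,8],
   .c 5 7 [6]]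

/-- Certificates for three neighbours, by segment lengths. -/
def certs3 : ℕ → ℕ → ℕ → List Cert
  | 1, 1, 1 =>
    [.c 1 3 [2],
     .h [0,1,2,3,4,6,5],
     .h [0,1,2,6,5,4,3],
     .h [0,1,6,5,4,2,3],
     .c 1 5 [6],
     .k [(2,5),(3,6)] [5] [3] [0,2,4,6]]
  | 1, 1, 2 =>
    [.c 1 3 [2],
     .h [0,1,2,3,4,7,6,5],
     .h [0,3,2,1,7,6,4,5],
     .h [0,1,2,7,6,5,4,3],
     .h [0,1,7,6,2,3,4,5],
     .h [0,1,7,6,5,4,2,3],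
     .c 1 5 [6,7],
     .k [(3,6),(5,7)] [5] [3,2,1] [0,4,6,7],
     .c 1 6 [7],
     .k [(2,5),(3,7)] [6,5] [3] [0,2,4,7]]
  | 1, 1, 3 =>
    [.c 1 3 [2],
     .h [0,1,2,3,4,8,27,6,5],
     .h [0,3,2,1,8,27,6,4,5],
     .h [0,1,2,8,27,6,5,4,3],
     .h [0,1,8,27,6,2,3,4,5],
     .h [0,1,8,27,6,5,4,2,3],
     .k [(3,7)] [7,3] [5,1,0] [2,4,6,8],
     .k [(3,6),(5,8)] [5] [3,2,1] [0,4,6,8],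
     .k [(3,6),(5,7)] [7,5] [3,2,1] [0,4,6,8],
     .c 1 6 [7,8],
     .k [(2,5),(3,8)] [7,6,5] [3] [0,2,4,8],
     .c 1 5 [6,7,8],
     .k [(2,5),(4,7)] [7,8,1] [5] [0,2,4,6],
     .c 3 5 [4],
     .k [(2,7),(4,7)] [7] [5,1,0] [2,4,6,8],
     .k [(1,4),(2,7)] [7,6,5] [1] [0,2,4,8]]
  | 1, 2, 1 =>
    [.c 1 3 [2],
     .h [0,1,2,3,4,5,7,6],
     .h [0,3,2,1,7,4,5,6],
     .h [0,1,2,7,6,5,4,3],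
     .h [0,3,4,5,2,1,7,6],
     .h [0,1,7,6,5,4,2,3],
     .c 1 6 [7],
     .k [(2,6),(3,7)] [6] [4,3] [0,2,5,7]]
  | 1, 2, 2 =>
    [.c 1 3 [2],
     .h [0,1,2,3,4,5,8,7,6],
     .h [0,1,2,3,4,5,7,8,6],
     .h [0,3,2,1,8,7,4,5,6],
     .h [0,1,2,8,7,6,5,4,3],
     .h [0,1,8,7,2,3,4,5,6],
     .h [0,3,4,5,2,1,8,7,6],
     .h [0,1,8,7,6,5,4,2,3],
     .c 1 6 [7,8],
     .k [(3,7),(6,8)] [6] [4,3,2,1] [0,5,7,8],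
     .c 1 7 [8],
     .k [(2,6),(3,8)] [7,6] [4,3] [0,2,5,8],
     .k [(4,8)] [8,4] [6,0] [1,3,5,7]]
  | 1, 2, 3 =>
    [.c 1 3 [2],
     .h [0,1,2,3,4,5,9,28,7,6],
     .h [0,3,2,1,9,28,7,4,5,6],
     .h [0,1,2,9,28,7,6,5,4,3],
     .h [0,1,9,28,7,2,3,4,5,6],
     .h [0,3,4,5,2,1,9,28,7,6],
     .h [0,1,9,28,7,6,5,4,2,3],
     .k [(4,8)] [8,4] [6,1,0] [3,5,7,9],
     .k [(3,8)] [8,3] [5,6,1,0] [2,4,7,9],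
     .k [(3,7),(6,9)] [9,1] [7,3] [0,2,6,8],
     .k [(3,7),(6,8)] [8,6] [4,3,2,1] [0,5,7,9],
     .k [(3,5),(4,6)] [8,7,6] [3,2,1] [0,4,5,9],
     .h [0,1,9,28,7,5,4,3,2,6],
     .c 1 7 [8,9],
     .k [(2,6),(3,9)] [8,7,6] [4,3] [0,2,5,9],
     .c 1 6 [7,8,9],
     .k [(2,6),(5,8)] [8,9,1] [6] [0,2,5,7],
     .c 3 5 [4],
     .c 4 6 [5],
     .k [(4,9)] [9,4] [7,6,0] [1,3,5,8],
     .k [(1,5),(2,8)] [8,7,6] [1] [0,2,5,9],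
     .k [(1,4),(3,5)] [8,7,6,5] [2,1] [0,3,4,9],
     .k [(2,8),(5,7)] [8,7] [4,3,1,0] [2,5,6,9],
     .k [(2,8),(5,8)] [8] [6,1,0] [2,5,7,9]]
  | 1, 3, 1 =>
    [.c 1 3 [2],
     .h [0,1,2,3,4,5,6,8,7],
     .h [0,3,2,1,8,4,5,6,7],
     .h [0,1,2,8,7,6,25,4,3],
     .h [0,3,4,5,6,2,1,8,7],
     .h [0,1,8,7,6,25,4,2,3],
     .k [(2,7),(3,8)] [7] [5,4,3] [0,2,6,8],
     .c 1 7 [8],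
     .k [(2,7),(5,8)] [7] [5,4,3] [0,2,6,8],
     .k [(2,5),(3,8)] [7,6,5] [3] [0,2,4,8],
     .k [(2,5),(5,8)] [7,0] [5,2] [1,3,6,8]]
  | 1, 3, 2 =>
    [.c 1 3 [2],
     .h [0,1,2,3,4,5,6,9,8,7],
     .h [0,1,2,3,4,5,6,8,9,7],
     .h [0,3,2,1,9,8,4,5,6,7],
     .h [0,1,2,9,8,7,6,25,4,3],
     .h [0,1,9,8,2,3,4,5,6,7],
     .h [0,3,4,5,6,2,1,9,8,7],
     .h [0,1,9,8,7,6,25,4,2,3],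
     .k [(5,9)] [9,5] [7,3,0] [1,4,6,8],
     .k [(5,8),(7,9)] [7] [5,4,3,2,1] [0,6,8,9],
     .k [(3,8),(7,9)] [7] [5,4,3,2,1] [0,6,8,9],
     .c 1 8 [9],
     .c 1 7 [8,9],
     .k [(2,5),(3,9)] [8,7,6,5] [3] [0,2,4,9],
     .k [(2,7),(3,9)] [8,7] [5,4,3] [0,2,6,9],
     .k [(4,9)] [9,4] [6,7,0] [1,3,5,8]]
  | 1, 3, 3 =>
    [.c 1 3 [2],
     .h [0,1,2,3,4,5,6,10,29,8,7],
     .h [0,1,2,3,4,5,6,8,9,10,7],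
     .h [0,3,2,1,10,29,8,4,5,6,7],
     .h [0,1,2,10,29,8,7,6,25,4,3],
     .h [0,1,10,29,8,2,3,4,5,6,7],
     .h [0,3,4,5,6,2,1,10,29,8,7],
     .h [0,1,10,29,8,7,6,25,4,2,3],
     .k [(5,10)] [10,5] [8,7,3,0] [1,4,6,9],
     .k [(5,9)] [9,5] [7,3,1,0] [4,6,8,10],
     .k [(5,8),(7,9)] [9,7] [5,4,3,2,1] [0,6,8,10],
     .k [(5,8),(7,10)] [7] [5,4,3,2,1] [0,6,8,10],
     .k [(4,9)] [9,4] [6,7,1,0] [3,5,8,10],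
     .k [(5,7),(6,9)] [9,10,1] [7,5,4,3] [0,2,6,8],
     .k [(3,9)] [9,3] [5,6,7,1,0] [2,4,8,10],
     .k [(3,8),(7,10)] [10,1] [8,3] [0,2,7,9],
     .k [(3,8),(7,9)] [9,7] [5,4,3,2,1] [0,6,8,10],
     .k [(3,5),(4,7)] [9,8,7] [5,3,2,1] [0,4,6,10],
     .k [(2,9),(5,8)] [9,8] [4,3,1,0] [2,5,7,10],
     .k [(2,5),(2,9)] [8,7,0] [5,2] [1,3,6,9],
     .c 1 8 [9,10],
     .c 3 6 [4,5],
     .c 3 7 [4,5,6],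
     .k [(5,7),(6,8)] [8,9,10,1] [5,4,3] [0,2,6,7],
     .c 4 6 [5],
     .k [(1,4),(2,9)] [9,8,7] [5,4,1] [0,2,6,10],
     .k [(4,10)] [10,4] [8,6,7,0] [1,3,5,9],
     .k [(1,5)] [9,8,7,3,0] [5,1] [2,4,6,10],
     .k [(2,7),(3,10)] [9,8,7] [5,4,3] [0,2,6,10],
     .c 1 7 [8,9,10],
     .k [(2,5),(3,10)] [9,8,7,6,5] [3] [0,2,4,10],
     .k [(1,6),(5,7)] [9,8,7] [4,3,2,1] [0,5,6,10],
     .k [(6,8),(7,9)] [9,10,1] [6,5,4,3] [0,2,7,8],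
     .k [(2,7),(6,9)] [9,10,1] [7] [0,2,6,8],
     .k [(2,5),(6,9)] [9,6,5] [3,1,0] [2,4,7,10]]
  | 2, 1, 1 =>
    [.h [0,1,2,3,4,5,7,6],
     .h [0,1,2,3,7,6,5,4],
     .h [0,4,5,3,2,1,7,6],
     .h [0,1,7,2,3,4,5,6],
     .h [0,1,7,6,5,2,3,4],
     .k [(3,6),(4,7)] [6] [4] [0,3,5,7],
     .c 1 6 [7],
     .k [(2,6),(4,7)] [6] [4,3] [0,2,5,7],
     .c 1 4 [2,3]]
  | 2, 1, 2 =>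
    [.h [0,1,2,3,4,5,8,7,6],
     .h [0,4,3,2,1,8,7,5,6],
     .h [0,1,2,3,8,7,6,5,4],
     .h [0,1,2,3,7,8,6,5,4],
     .h [0,1,2,3,7,8,4,5,6],
     .h [0,4,5,3,2,1,8,7,6],
     .h [0,1,8,7,2,3,4,5,6],
     .h [0,1,8,7,6,5,2,3,4],
     .c 1 7 [8],
     .k [(4,7),(6,8)] [6] [4,3,2,1] [0,5,7,8],
     .k [(4,7),(4,8)] [6,1,0] [4,3] [2,5,7,8],
     .c 4 6 [5],
     .c 6 8 [7],
     .h [0,1,5,4,3,2,8,7,6],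
     .k [(1,7),(4,8)] [6,5,4] [2,1] [0,3,7,8],
     .c 1 6 [7,8]]
  | 2, 1, 3 =>
    [.h [0,1,2,3,4,5,9,28,7,6],
     .h [0,4,3,2,1,9,28,7,5,6],
     .h [0,1,2,3,9,28,7,6,5,4],
     .h [0,4,5,3,2,1,9,28,7,6],
     .h [0,1,9,28,7,2,3,4,5,6],
     .h [0,1,9,28,7,6,5,2,3,4],
     .k [(4,8)] [8,4] [6,2,1,0] [3,5,7,9],
     .k [(4,7),(6,9)] [6] [4,3,2,1] [0,5,7,9],
     .k [(4,7),(6,8)] [8,6] [4,3,2,1] [0,5,7,9],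
     .k [(3,8)] [8,3] [6,1,0] [2,4,7,9],
     .k [(3,6),(4,9)] [8,7,6] [4] [0,3,5,9],
     .c 1 6 [7,8,9],
     .c 1 7 [8,9],
     .k [(2,6),(4,9)] [5,4] [2,1] [0,3,6,9],
     .k [(2,6),(5,8)] [8,9,1] [6] [0,2,5,7],
     .c 2 4 [3],
     .c 4 6 [5],
     .k [(3,6),(5,8)] [8,9,1] [6,3] [0,2,5,7],
     .k [(3,7)] [8,7,3] [1,0] [2,4,6,9],
     .h [0,1,5,4,3,2,9,28,7,6],
     .k [(1,5),(2,8)] [8,7,6] [1] [0,2,5,9],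
     .c 1 4 [2,3],
     .k [(2,8),(5,8)] [8] [6,1,0] [2,5,7,9],
     .h [0,1,3,2,9,28,7,6,5,4]]
  | 2, 2, 1 =>
    [.h [0,1,2,3,4,5,6,8,7],
     .h [0,4,3,2,1,8,5,6,7],
     .h [0,1,2,3,8,7,6,5,4],
     .h [0,4,5,6,3,2,1,8,7],
     .h [0,1,2,3,5,6,7,8,4],
     .h [0,1,8,2,3,4,5,6,7],
     .c 1 7 [8],
     .h [0,1,8,7,6,5,2,3,4],
     .k [(3,7),(4,8)] [7] [5,4] [0,3,6,8],
     .k [(2,7),(4,8)] [7] [5,4,3] [0,2,6,8],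
     .c 1 4 [2,3],
     .k [(2,6)] [6,2] [4,0] [1,3,5,7]]
  | 2, 2, 2 =>
    [.h [0,1,2,3,4,5,6,9,8,7],
     .h [0,1,2,3,4,5,6,8,9,7],
     .h [0,4,3,2,1,9,8,5,6,7],
     .h [0,4,3,2,1,9,8,6,5,7],
     .h [0,1,2,3,9,8,7,6,5,4],
     .h [0,1,2,3,8,9,7,6,5,4],
     .h [0,1,2,3,8,9,4,5,6,7],
     .h [0,4,5,6,3,2,1,9,8,7],
     .h [0,1,2,3,5,6,7,8,9,4],
     .h [0,1,2,9,8,7,6,5,3,4],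
     .h [0,1,9,8,2,3,4,5,6,7],
     .h [0,1,9,8,7,5,6,2,3,4],
     .h [0,1,9,8,7,6,5,2,3,4],
     .c 1 8 [9],
     .h [0,4,3,2,6,5,1,9,8,7],
     .k [(4,8),(7,9)] [7] [5,4,3,2,1] [0,6,8,9],
     .c 4 6 [5],
     .k [(5,9)] [9,5] [7,0] [1,4,6,8],
     .c 4 7 [5,6],
     .h [0,1,6,5,4,3,2,9,8,7],
     .h [0,1,5,6,7,8,9,2,3,4],
     .k [(3,7),(4,9)] [8,7] [5,4] [0,3,6,9],
     .c 1 7 [8,9],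
     .k [(2,7),(4,9)] [9,4] [7,2] [0,1,3,8],
     .c 1 4 [2,3]]
  | 2, 2, 3 =>
    [.c 1 3 [2],
     .h [0,1,2,3,4,5,6,10,29,8,7],
     .h [0,4,3,2,1,10,29,8,5,6,7],
     .h [0,4,3,2,1,10,29,8,6,5,7],
     .h [0,1,2,3,10,29,8,7,6,5,4],
     .h [0,4,5,6,3,2,1,10,29,8,7],
     .h [0,4,6,5,3,2,1,10,29,8,7],
     .h [0,1,2,10,29,8,7,6,5,3,4],
     .h [0,1,10,29,8,2,3,4,5,6,7],
     .h [0,1,10,29,8,7,5,6,2,3,4],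
     .h [0,4,5,6,8,9,10,1,2,3,7],
     .h [0,1,10,29,8,6,5,4,3,2,7],
     .h [0,1,10,29,8,7,6,5,2,3,4],
     .h [0,1,10,29,8,3,2,7,6,5,4],
     .h [0,1,10,29,8,7,6,2,3,5,4],
     .h [0,4,3,2,6,5,1,10,29,8,7],
     .h [0,1,10,29,8,7,6,5,3,2,4],
     .k [(5,9)] [9,5] [7,1,0] [4,6,8,10],
     .k [(5,7),(6,9)] [9,10,1] [7,5,4,3] [0,2,6,8],
     .k [(4,9)] [9,4] [6,7,2,1,0] [3,5,8,10],
     .k [(4,8),(7,10)] [10,1] [8,4,3] [0,2,7,9],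
     .k [(4,8),(7,9)] [9,7] [5,4,3,2,1] [0,6,8,10],
     .k [(4,6),(5,7)] [9,8,7] [4,3,2,1] [0,5,6,10],
     .k [(3,9)] [9,3] [7,1,0] [2,4,8,10],
     .k [(3,7),(4,10)] [9,8,7] [5,4] [0,3,6,10],
     .c 1 7 [8,9,10],
     .c 1 8 [9,10],
     .k [(2,7),(4,10)] [6,5,4] [2,1] [0,3,7,10],
     .k [(2,7),(6,9)] [9,10,1] [7] [0,2,6,8],
     .c 4 6 [5],
     .c 5 7 [6],
     .k [(5,10)] [10,5] [8,7,0] [1,4,6,9],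
     .k [(1,6),(2,9)] [9,8,7] [1] [0,2,6,10],
     .h [0,1,6,5,4,3,2,10,29,8,7],
     .c 1 4 [2,3],
     .h [0,1,5,6,7,8,9,10,2,3,4],
     .k [(1,5),(4,6)] [9,8,7,6] [3,2,1] [0,4,5,10],
     .k [(2,9),(6,8)] [9,8] [5,4,1,0] [2,6,7,10],
     .k [(2,9),(6,9)] [9] [7,1,0] [2,6,8,10],
     .k [(3,7),(6,9)] [9,10,1] [7,3] [0,2,6,8],
     .h [0,1,10,29,8,3,2,4,5,6,7]]
  | 2, 3, 1 =>
    [.c 1 3 [2],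
     .h [0,1,2,3,4,5,6,7,9,8],
     .h [0,4,3,2,1,9,5,6,7,8],
     .h [0,1,2,3,9,8,7,26,5,4],
     .h [0,4,5,6,7,3,2,1,9,8],
     .h [0,1,9,2,3,4,5,6,7,8],
     .h [0,4,3,5,6,7,2,1,9,8],
     .h [0,1,9,8,7,26,5,2,3,4],
     .h [0,1,9,8,7,26,5,3,2,4],
     .k [(3,8),(4,9)] [8] [6,5,4] [0,3,7,9],
     .c 1 8 [9],
     .k [(3,8),(6,9)] [8] [6,5,4] [0,3,7,9],
     .c 2 4 [3],
     .k [(2,8),(6,9)] [8] [6,5,4,3] [0,2,7,9],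
     .k [(3,6),(4,9)] [8,7,6] [4] [0,3,5,9],
     .k [(2,8),(4,9)] [8] [6,5,4,3] [0,2,7,9],
     .c 1 4 [2,3],
     .k [(2,6)] [7,6,2] [4,0] [1,3,5,8],
     .h [0,4,5,6,7,2,3,1,9,8],
     .k [(3,6),(6,9)] [8,4,0] [6] [3,5,7,9]]
  | 2, 3, 2 =>
    [.h [0,1,2,3,4,5,6,7,10,9,8],
     .h [0,1,2,3,4,5,6,7,9,10,8],
     .h [0,4,3,2,1,10,9,5,6,7,8],
     .h [0,1,2,3,10,9,8,7,26,5,4],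
     .h [0,1,2,3,9,10,8,7,26,5,4],
     .h [0,1,2,3,9,10,4,5,6,7,8],
     .h [0,4,5,6,7,3,2,1,10,9,8],
     .h [0,1,2,10,9,3,4,5,6,7,8],
     .h [0,1,2,3,5,6,7,8,9,10,4],
     .h [0,1,2,10,9,8,7,26,5,3,4],
     .h [0,1,10,9,2,3,4,5,6,7,8],
     .h [0,1,10,2,3,4,5,6,7,9,8],
     .h [0,1,10,9,8,7,26,5,2,3,4],
     .h [0,1,9,10,2,3,4,5,6,7,8],
     .k [(6,10)] [10,6] [8,4,0] [1,5,7,9],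
     .k [(6,9),(8,10)] [8] [6,5,4,3,2,1] [0,7,9,10],
     .k [(4,9),(8,10)] [8] [6,5,4,3,2,1] [0,7,9,10],
     .c 1 9 [10],
     .c 2 4 [3],
     .k [(3,8),(6,9)] [8] [6,5,4] [0,3,7,9],
     .k [(5,10)] [10,5] [7,8,0] [1,4,6,9],
     .c 8 10 [9],
     .h [0,1,3,2,10,9,8,7,26,5,4],
     .k [(3,6),(4,9)] [8,7,6] [4] [0,3,5,9],
     .k [(3,8),(4,10)] [10,1] [8,3] [0,2,4,9],
     .c 1 8 [9,10],
     .k [(3,8),(4,9)] [8] [6,5,4] [0,3,7,9],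
     .k [(2,8),(4,10)] [10,4] [8,2] [0,1,3,9],
     .k [(2,6)] [7,6,2] [4,0] [1,3,5,8],
     .c 1 4 [2,3],
     .k [(3,6),(4,10)] [9,8,7,6] [4] [0,3,5,10],
     .h [0,4,5,6,7,2,3,1,10,9,8],
     .k [(3,6),(6,9)] [8,4,0] [6] [3,5,7,9]]
  | 2, 3, 3 =>
    [.h [0,1,2,3,4,5,6,7,11,30,9,8],
     .h [0,1,2,3,4,5,6,7,9,10,11,8],
     .h [0,4,3,2,1,11,30,9,5,6,7,8],
     .h [0,1,2,3,11,30,9,8,7,26,5,4],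
     .h [0,4,5,6,7,3,2,1,11,30,9,8],
     .h [0,1,2,3,5,6,7,8,9,10,11,4],
     .h [0,1,2,11,30,9,8,7,26,5,3,4],
     .h [0,1,11,30,9,2,3,4,5,6,7,8],
     .h [0,1,11,30,9,8,3,2,7,26,5,4],
     .h [0,1,11,30,9,8,7,26,5,2,3,4],
     .h [0,4,3,5,6,7,2,1,11,30,9,8],
     .k [(6,11)] [11,6] [9,8,4,0] [1,5,7,10],
     .k [(6,10)] [10,6] [8,4,1,0] [5,7,9,11],
     .k [(6,9),(8,10)] [10,8] [6,5,4,3,2,1] [0,7,9,11],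
     .k [(6,9),(7,10)] [10,11,1] [6,5,4,3] [0,2,7,9],
     .k [(6,9),(8,11)] [8] [6,5,4,3,2,1] [0,7,9,11],
     .k [(5,10)] [10,5] [7,8,1,0] [4,6,9,11],
     .k [(6,8),(7,10)] [10,11,1] [8,6,5,4,3] [0,2,7,9],
     .k [(4,10)] [10,4] [6,7,8,2,1,0] [3,5,9,11],
     .k [(4,9),(8,11)] [11,1] [9,4,3] [0,2,8,10],
     .k [(4,9),(8,10)] [10,8] [6,5,4,3,2,1] [0,7,9,11],
     .k [(4,7),(6,8)] [10,9,8] [5,4,3,2,1] [0,6,7,11],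
     .k [(3,10)] [10,3] [8,1,0] [2,4,9,11],
     .k [(4,6),(5,8)] [10,9,8] [6,4,3,2,1] [0,5,7,11],
     .k [(3,8),(6,9)] [8] [6,5,4] [0,3,7,9],
     .k [(3,6),(4,11)] [10,9,8,7,6] [4] [0,3,5,11],
     .k [(2,10),(3,6)] [9,8,0] [6,3,2] [1,4,7,10],
     .k [(2,6)] [7,6,2] [4,0] [1,3,5,8],
     .c 1 8 [9,10,11],
     .k [(3,6),(7,10)] [10,7,6] [4,1,0] [3,5,8,11],
     .c 2 4 [3],
     .c 4 7 [5,6],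
     .c 4 8 [5,6,7],
     .c 5 7 [6],
     .k [(5,11)] [11,5] [9,7,8,0] [1,4,6,10],
     .k [(1,6)] [10,9,8,4,0] [6,2,1] [3,5,7,11],
     .k [(2,11),(3,6)] [10,9,8,0] [6,3,2] [1,4,7,11],
     .c 1 9 [10,11],
     .c 5 8 [6,7],
     .k [(2,8),(4,11)] [11,4] [9,8,2] [0,1,3,10],
     .c 1 4 [2,3],
     .h [0,4,5,6,7,2,3,1,11,30,9,8],
     .k [(1,5),(4,6)] [10,9,8,7,6] [3,2,1] [0,4,5,11],
     .k [(1,7),(6,8)] [10,9,8] [5,4,3,2,1] [0,6,7,11],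
     .k [(3,5),(4,6)] [10,9,8,7,6] [3,2,1] [0,4,5,11],
     .k [(3,9)] [10,9,3] [1,0] [2,4,8,11],
     .k [(2,10),(6,9)] [10,9] [5,4,1,0] [2,6,8,11],
     .h [0,1,3,2,11,30,9,8,7,26,5,4],
     .k [(6,8),(7,9)] [9,10,11,1] [6,5,4,3] [0,2,7,8],
     .k [(7,9),(8,10)] [10,11,1] [7,6,5,4,3] [0,2,8,9]]
  | 3, 1, 1 =>
    [.h [0,1,2,3,4,5,6,8,7],
     .h [0,1,2,3,4,8,7,6,5],
     .h [0,5,6,4,23,2,1,8,7],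
     .h [0,1,8,2,3,4,5,6,7],
     .h [0,1,8,7,6,2,3,4,5],
     .k [(4,7),(5,8)] [7] [5] [0,4,6,8],
     .k [(3,7)] [7,3] [5,1,0] [2,4,6,8],
     .k [(3,6),(5,8)] [5] [3,2,1] [0,4,6,8],
     .k [(3,6),(3,8)] [5,1,0] [3] [2,4,6,8],
     .c 1 7 [8],
     .c 5 7 [6],
     .k [(1,6),(3,8)] [5,4,3] [1] [0,2,6,8],
     .k [(2,7),(5,8)] [7] [5,4,3] [0,2,6,8],
     .c 1 5 [2,3,4]]
  | 3, 1, 2 =>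
    [.h [0,1,2,3,4,5,6,9,8,7],
     .h [0,5,4,23,2,1,9,8,6,7],
     .h [0,1,2,3,4,9,8,7,6,5],
     .h [0,5,6,4,23,2,1,9,8,7],
     .h [0,1,9,8,2,3,4,5,6,7],
     .h [0,1,9,8,7,6,2,3,4,5],
     .h [0,1,8,9,2,3,4,5,6,7],
     .k [(5,8),(7,9)] [7] [5,4,3,2,1] [0,6,8,9],
     .k [(4,7),(5,9)] [8,7] [5] [0,4,6,9],
     .k [(3,9),(5,8)] [7,1,0] [5,4,3] [2,6,8,9],
     .k [(3,8)] [8,3] [5,1,0] [2,4,7,9],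
     .k [(3,7)] [8,7,3] [5,1,0] [2,4,6,9],
     .k [(3,6),(5,9)] [5] [3,2,1] [0,4,6,9],
     .c 1 7 [8,9],
     .c 1 8 [9],
     .k [(3,6),(5,8)] [8,5] [3,2,1] [0,4,6,9],
     .c 5 7 [6],
     .h [0,1,6,5,4,23,2,9,8,7],
     .c 7 9 [8],
     .k [(1,8),(3,9)] [7,6,5,4,3] [1] [0,2,8,9],
     .k [(2,7),(5,9)] [9,1] [7,6] [0,2,5,8],
     .c 1 5 [2,3,4],
     .k [(4,8)] [8,4] [2,1,0] [3,5,7,9]]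
  | 3, 1, 3 =>
    [.h [0,1,2,3,4,5,6,10,29,8,7],
     .h [0,5,4,23,2,1,10,29,8,6,7],
     .h [0,1,2,3,4,10,29,8,7,6,5],
     .h [0,5,6,4,23,2,1,10,29,8,7],
     .h [0,1,10,29,8,2,3,4,5,6,7],
     .h [0,1,10,29,8,7,6,2,3,4,5],
     .k [(5,9)] [9,5] [7,3,2,1,0] [4,6,8,10],
     .k [(5,8),(7,10)] [7] [5,4,3,2,1] [0,6,8,10],
     .k [(5,8),(7,9)] [9,7] [5,4,3,2,1] [0,6,8,10],
     .k [(4,9)] [9,4] [7,2,1,0] [3,5,8,10],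
     .k [(4,7),(5,10)] [9,8,7] [5] [0,4,6,10],
     .k [(3,9)] [9,3] [7,5,1,0] [2,4,8,10],
     .k [(3,8)] [9,8,3] [5,1,0] [2,4,7,10],
     .k [(3,7)] [9,8,7,3] [5,1,0] [2,4,6,10],
     .k [(3,6),(5,10)] [5] [3,2,1] [0,4,6,10],
     .k [(3,10),(6,9)] [10,9] [7,4,5,0] [1,3,6,8],
     .k [(4,7),(6,9)] [9,10,1] [7,4,3] [0,2,6,8],
     .k [(3,6),(6,9)] [9,6] [2,1,0] [3,5,7,10],
     .k [(2,9),(3,6)] [8,7,0] [4,3,2] [1,5,6,9],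
     .k [(1,8),(7,9)] [9,7] [5,4,3,2,1] [0,6,8,10],
     .c 1 7 [8,9,10],
     .k [(2,7),(5,10)] [6,5] [3,2,1] [0,4,7,10],
     .c 5 7 [6],
     .k [(1,6),(2,9)] [9,8,7] [1] [0,2,6,10],
     .c 7 10 [8,9],
     .h [0,1,6,5,4,23,2,10,29,8,7],
     .c 8 10 [9],
     .k [(1,9),(3,10)] [8,7,6,5,4,3] [1] [0,2,9,10],
     .c 1 8 [9,10],
     .k [(2,7),(6,9)] [9,10,1] [7] [0,2,6,8],
     .c 1 5 [2,3,4],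
     .k [(2,10),(3,6)] [9,8,7,0] [4,3,2] [1,5,6,10],
     .k [(2,9),(6,9)] [9] [7,1,0] [2,6,8,10],
     .k [(4,8)] [9,8,4] [2,1,0] [3,5,7,10],
     .k [(2,10),(6,9)] [10,9] [7,3,4,5,0] [1,2,6,8]]
  | 3, 2, 1 =>
    [.h [0,1,2,3,4,5,6,7,9,8],
     .h [0,5,4,23,2,1,9,6,7,8],
     .h [0,1,2,3,4,9,8,7,6,5],
     .h [0,5,6,7,4,23,2,1,9,8],
     .h [0,1,2,3,4,6,7,8,9,5],
     .h [0,5,7,6,4,23,2,1,9,8],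
     .h [0,1,9,2,3,4,5,6,7,8],
     .h [0,1,9,8,6,7,2,3,4,5],
     .h [0,1,9,8,7,2,3,4,6,5],
     .h [0,1,9,8,7,6,2,3,4,5],
     .h [0,5,4,23,2,7,6,1,9,8],
     .k [(5,7),(6,8)] [8] [5,4,3,2,1] [0,6,7,9],
     .k [(4,8),(5,9)] [8] [6,5] [0,4,7,9],
     .k [(3,8)] [8,3] [6,5,1,0] [2,4,7,9],
     .k [(3,7)] [7,3] [5,1,0] [2,4,6,8],
     .k [(3,6),(5,9)] [5] [3,2,1] [0,4,6,9],
     .k [(3,6),(3,9)] [5,1,0] [3] [2,4,6,9],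
     .c 1 8 [9],
     .c 5 7 [6],
     .c 6 8 [7],
     .k [(1,7),(3,9)] [6,5,4,3] [1] [0,2,7,9],
     .k [(2,8),(5,9)] [8] [6,5,4,3] [0,2,7,9],
     .c 1 5 [2,3,4],
     .k [(1,6),(5,7)] [8,7] [4,3,2,1] [0,5,6,9]]
  | 3, 2, 2 =>
    [.h [0,1,2,3,4,5,6,7,10,9,8],
     .h [0,1,2,3,4,5,6,7,9,10,8],
     .h [0,1,2,3,4,5,6,10,9,7,8],
     .h [0,5,4,23,2,1,10,9,6,7,8],
     .h [0,1,2,3,4,5,9,10,6,7,8],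
     .h [0,1,2,3,4,10,9,8,7,6,5],
     .h [0,5,6,7,4,23,2,1,10,9,8],
     .h [0,5,9,10,1,2,3,4,6,7,8],
     .h [0,1,2,3,4,6,7,8,9,10,5],
     .h [0,1,10,9,2,3,4,5,6,7,8],
     .h [0,1,10,9,8,6,7,2,3,4,5],
     .h [0,1,10,2,3,4,5,6,7,9,8],
     .h [0,1,10,9,8,7,6,2,3,4,5],
     .h [0,1,9,10,2,3,4,5,6,7,8],
     .h [0,5,4,23,2,7,6,1,10,9,8],
     .k [(5,9),(8,10)] [8] [6,5,4,3,2,1] [0,7,9,10],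
     .k [(5,7),(6,8)] [9,8] [5,4,3,2,1] [0,6,7,10],
     .k [(4,8),(5,10)] [9,8] [6,5] [0,4,7,10],
     .k [(3,10),(5,9)] [8,1,0] [6,5,4,3] [2,7,9,10],
     .k [(3,9)] [9,3] [5,1,0] [2,4,8,10],
     .k [(3,8)] [9,8,3] [6,5,1,0] [2,4,7,10],
     .k [(3,7)] [7,3] [5,1,0] [2,4,6,8],
     .k [(3,6),(5,10)] [5] [3,2,1] [0,4,6,10],
     .h [0,5,4,23,2,1,9,10,6,7,8],
     .c 1 8 [9,10],
     .c 1 9 [10],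
     .k [(3,6),(5,9)] [9,5] [3,2,1] [0,4,6,10],
     .c 5 7 [6],
     .c 6 8 [7],
     .h [0,1,7,6,5,4,23,2,10,9,8],
     .c 8 10 [9],
     .k [(1,9),(3,10)] [8,7,6,5,4,3] [1] [0,2,9,10],
     .k [(2,8),(5,10)] [10,1] [8,7,6] [0,2,5,9],
     .c 1 5 [2,3,4],
     .h [0,1,6,7,8,9,10,2,3,4,5],
     .k [(3,10),(7,9)] [10,9] [6,4,5,0] [1,3,7,8],
     .k [(4,9)] [9,4] [2,1,0] [3,5,8,10]]
  | 3, 2, 3 =>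
    [.h [0,1,2,3,4,5,6,7,11,30,9,8],
     .h [0,1,2,3,4,5,6,7,9,10,11,8],
     .h [0,5,4,23,2,1,11,30,9,6,7,8],
     .h [0,5,4,23,2,1,11,30,9,7,6,8],
     .h [0,1,2,3,4,11,30,9,8,7,6,5],
     .h [0,5,6,7,4,23,2,1,11,30,9,8],
     .h [0,5,7,6,4,23,2,1,11,30,9,8],
     .h [0,1,11,30,9,2,3,4,5,6,7,8],
     .h [0,1,2,3,4,6,7,8,9,10,11,5],
     .h [0,1,11,30,9,8,6,7,2,3,4,5],
     .h [0,1,11,30,9,8,7,2,3,4,6,5],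
     .h [0,1,11,30,9,8,7,6,2,3,4,5],
     .h [0,5,4,23,2,7,6,1,11,30,9,8],
     .k [(6,10)] [10,6] [8,1,0] [5,7,9,11],
     .k [(6,8),(7,10)] [10,11,1] [8,6,5,4,3] [0,2,7,9],
     .k [(5,10)] [10,5] [7,8,3,2,1,0] [4,6,9,11],
     .k [(5,9),(8,11)] [11,1] [9,5,4,3] [0,2,8,10],
     .k [(5,9),(8,10)] [10,8] [6,5,4,3,2,1] [0,7,9,11],
     .k [(5,7),(6,8)] [10,9,8] [5,4,3,2,1] [0,6,7,11],
     .k [(4,10)] [10,4] [8,2,1,0] [3,5,9,11],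
     .k [(4,8),(5,11)] [10,9,8] [6,5] [0,4,7,11],
     .k [(3,10)] [10,3] [8,5,1,0] [2,4,9,11],
     .k [(3,9)] [10,9,3] [5,1,0] [2,4,8,11],
     .k [(3,8)] [10,9,8,3] [6,5,1,0] [2,4,7,11],
     .k [(3,7)] [7,3] [5,1,0] [2,4,6,8],
     .k [(3,6),(5,11)] [5] [3,2,1] [0,4,6,11],
     .k [(3,11),(7,10)] [11,10] [8,4,5,0] [1,3,7,9],
     .k [(2,10),(3,6)] [9,8,0] [6,3,2] [1,5,7,10],
     .k [(1,9),(8,10)] [10,8] [6,5,4,3,2,1] [0,7,9,11],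
     .c 1 8 [9,10,11],
     .k [(2,8),(5,11)] [7,6,5] [3,2,1] [0,4,8,11],
     .k [(4,8),(7,10)] [10,11,1] [8,4,3] [0,2,7,9],
     .c 5 7 [6],
     .c 6 8 [7],
     .k [(6,11)] [11,6] [9,8,0] [1,5,7,10],
     .k [(1,7),(2,10)] [10,9,8] [1] [0,2,7,11],
     .c 8 11 [9,10],
     .h [0,1,7,6,5,4,23,2,11,30,9,8],
     .c 9 11 [10],
     .k [(1,10),(3,11)] [9,8,7,6,5,4,3] [1] [0,2,10,11],
     .c 1 9 [10,11],
     .k [(2,8),(7,10)] [10,11,1] [8] [0,2,7,9],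
     .k [(3,6),(7,10)] [10,7,6] [2,1,0] [3,5,8,11],
     .c 1 5 [2,3,4],
     .k [(2,11),(3,6)] [10,9,8,0] [6,3,2] [1,5,7,11],
     .k [(1,6),(5,7)] [10,9,8,7] [4,3,2,1] [0,5,6,11],
     .k [(2,10),(7,9)] [10,9] [6,5,1,0] [2,7,8,11],
     .h [0,1,6,7,8,9,10,11,2,3,4,5],
     .h [0,5,6,4,23,2,1,11,30,9,7,8],
     .k [(4,9)] [10,9,4] [2,1,0] [3,5,8,11],
     .k [(2,10),(7,10)] [10] [8,1,0] [2,7,9,11],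
     .k [(4,6),(7,10)] [10,7,6] [3,2,1,0] [4,5,8,11],
     .k [(7,9),(8,10)] [10,11,1] [7,6,5,4,3] [0,2,8,9]]
  | 3, 3, 1 =>
    [.h [0,1,2,3,4,5,6,7,8,10,9],
     .h [0,5,4,23,2,1,10,6,7,8,9],
     .h [0,1,2,3,4,10,9,8,27,6,5],
     .h [0,5,6,7,8,4,23,2,1,10,9],
     .h [0,1,2,3,4,6,7,8,9,10,5],
     .h [0,1,10,2,3,4,5,6,7,8,9],
     .h [0,1,10,9,8,27,6,2,3,4,5],
     .k [(5,8),(7,9)] [9] [6,5,4,3,2,1] [0,7,8,10],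
     .k [(5,7),(6,9)] [9] [7,5,4,3,2,1] [0,6,8,10],
     .k [(4,9),(7,10)] [9] [7,6,5] [0,4,8,10],
     .k [(4,7),(7,10)] [9,5,0] [7] [4,6,8,10],
     .k [(4,7),(5,10)] [9,8,7] [5] [0,4,6,10],
     .k [(3,10),(4,7)] [8,7,4,3] [1,0] [2,5,9,10],
     .k [(3,9)] [9,3] [7,6,5,1,0] [2,4,8,10],
     .k [(3,8)] [8,3] [6,5,1,0] [2,4,7,9],
     .k [(3,7)] [8,7,3] [5,1,0] [2,4,6,9],
     .k [(3,10),(7,10)] [10] [6,4,5,0] [1,3,7,9],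
     .k [(3,6),(5,7)] [9,8,7] [4,3,2,1] [0,5,6,10],
     .c 1 9 [10],
     .k [(3,6),(7,10)] [8,7,6] [2,1,0] [3,5,9,10],
     .c 5 8 [6,7],
     .c 5 9 [6,7,8],
     .c 6 8 [7],
     .k [(3,10),(4,6)] [8,7,6,4,3] [1,0] [2,5,9,10],
     .k [(1,7)] [9,5,0] [7,3,2,1] [4,6,8,10],
     .k [(2,7)] [8,7,2] [4,5,0] [1,3,6,9],
     .k [(1,6),(5,7)] [9,8,7] [4,3,2,1] [0,5,6,10],
     .k [(2,9),(7,10)] [9] [7,6,5,4,3] [0,2,8,10],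
     .k [(2,8)] [8,2] [6,4,5,0] [1,3,7,9],
     .c 1 5 [2,3,4],
     .k [(4,6),(7,10)] [8,7,6] [3,2,1,0] [4,5,9,10],
     .k [(1,8),(7,9)] [9] [6,5,4,3,2,1] [0,7,8,10],
     .c 6 9 [7,8]]
  | 3, 3, 2 =>
    [.h [0,1,2,3,4,5,6,7,8,11,10,9],
     .h [0,1,2,3,4,5,6,7,8,10,11,9],
     .h [0,5,4,23,2,1,11,10,6,7,8,9],
     .h [0,1,2,3,4,11,10,9,8,27,6,5],
     .h [0,5,6,7,8,4,23,2,1,11,10,9],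
     .h [0,5,10,11,1,2,3,4,6,7,8,9],
     .h [0,1,2,3,4,6,7,8,9,10,11,5],
     .h [0,1,11,10,2,3,4,5,6,7,8,9],
     .h [0,1,11,10,9,8,27,6,2,3,4,5],
     .h [0,1,11,2,3,4,5,6,7,8,10,9],
     .h [0,1,10,11,2,3,4,5,6,7,8,9],
     .k [(7,11)] [11,7] [9,5,0] [1,6,8,10],
     .k [(7,10),(9,11)] [9] [7,6,5,4,3,2,1] [0,8,10,11],
     .k [(5,10),(9,11)] [9] [7,6,5,4,3,2,1] [0,8,10,11],
     .k [(4,9),(5,11)] [10,9] [7,6,5] [0,4,8,11],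
     .k [(4,7),(5,10)] [9,8,7] [5] [0,4,6,10],
     .k [(4,7),(5,11)] [10,9,8,7] [5] [0,4,6,11],
     .k [(3,11),(5,10)] [9,1,0] [7,6,5,4,3] [2,8,10,11],
     .k [(3,10)] [10,3] [5,1,0] [2,4,9,11],
     .k [(3,9)] [10,9,3] [7,6,5,1,0] [2,4,8,11],
     .k [(3,8)] [8,3] [6,5,1,0] [2,4,7,9],
     .k [(3,7)] [8,7,3] [5,1,0] [2,4,6,9],
     .k [(3,6),(5,11)] [5] [3,2,1] [0,4,6,11],
     .k [(3,6),(5,8)] [10,9,8] [6,3,2,1] [0,5,7,11],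
     .k [(3,11),(7,10)] [11,10] [6,4,5,0] [1,3,7,9],
     .k [(3,6),(5,7)] [10,9,8,7] [4,3,2,1] [0,5,6,11],
     .c 1 9 [10,11],
     .c 5 9 [6,7,8],
     .h [0,1,6,7,8,9,10,11,2,3,4,5],
     .c 9 11 [10],
     .k [(1,7)] [10,9,5,0] [7,3,2,1] [4,6,8,11],
     .k [(1,10),(3,11)] [9,8,7,6,5,4,3] [1] [0,2,10,11],
     .k [(2,9),(5,11)] [11,5] [9,3,2] [0,1,4,10],
     .k [(2,7)] [8,7,2] [4,5,0] [1,3,6,9],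
     .c 1 5 [2,3,4],
     .k [(2,8)] [8,2] [6,4,5,0] [1,3,7,9],
     .c 1 10 [11],
     .k [(4,10)] [10,4] [2,1,0] [3,5,9,11],
     .h [0,1,8,27,6,5,4,23,2,11,10,9],
     .c 6 9 [7,8],
     .k [(2,11),(7,10)] [11,10] [6,3,4,5,0] [1,2,7,9],
     .k [(6,11)] [11,6] [8,9,0] [1,5,7,10],
     .k [(3,11),(8,10)] [11,10] [7,6,4,5,0] [1,3,8,9]]
  | 3, 3, 3 =>
    [.h [0,1,2,3,4,5,6,7,8,12,31,10,9],
     .h [0,1,2,3,4,5,6,7,8,10,11,12,9],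
     .h [0,5,4,23,2,1,12,31,10,6,7,8,9],
     .h [0,1,2,3,4,12,31,10,9,8,27,6,5],
     .h [0,5,6,7,8,4,23,2,1,12,31,10,9],
     .h [0,1,12,31,10,2,3,4,5,6,7,8,9],
     .h [0,1,2,3,4,6,7,8,9,10,11,12,5],
     .h [0,1,12,31,10,9,8,27,6,2,3,4,5],
     .k [(7,12)] [12,7] [10,9,5,0] [1,6,8,11],
     .k [(7,11)] [11,7] [9,5,1,0] [6,8,10,12],
     .k [(7,10),(9,11)] [11,9] [7,6,5,4,3,2,1] [0,8,10,12],
     .k [(7,10),(8,11)] [11,12,1] [7,6,5,4,3] [0,2,8,10],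
     .k [(7,10),(9,12)] [9] [7,6,5,4,3,2,1] [0,8,10,12],
     .k [(6,11)] [11,6] [8,9,1,0] [5,7,10,12],
     .k [(7,9),(8,11)] [11,12,1] [9,7,6,5,4,3] [0,2,8,10],
     .k [(5,11)] [11,5] [7,8,9,3,2,1,0] [4,6,10,12],
     .k [(5,10),(9,12)] [12,1] [10,5,4,3] [0,2,9,11],
     .k [(5,10),(9,11)] [11,9] [7,6,5,4,3,2,1] [0,8,10,12],
     .k [(5,8),(7,9)] [11,10,9] [6,5,4,3,2,1] [0,7,8,12],
     .k [(4,11)] [11,4] [9,2,1,0] [3,5,10,12],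
     .k [(4,9),(5,12)] [11,10,9] [7,6,5] [0,4,8,12],
     .k [(4,9),(8,11)] [11,12,1] [9,4,3] [0,2,8,10],
     .k [(5,7),(6,9)] [11,10,9] [7,5,4,3,2,1] [0,6,8,12],
     .k [(4,7),(5,12)] [11,10,9,8,7] [5] [0,4,6,12],
     .k [(3,11)] [11,3] [9,5,1,0] [2,4,10,12],
     .k [(3,10)] [11,10,3] [5,1,0] [2,4,9,12],
     .k [(3,9)] [11,10,9,3] [7,6,5,1,0] [2,4,8,12],
     .k [(3,8)] [8,3] [6,5,1,0] [2,4,7,9],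
     .k [(3,7)] [8,7,3] [5,1,0] [2,4,6,9],
     .k [(3,6),(5,12)] [5] [3,2,1] [0,4,6,12],
     .k [(3,12),(8,11)] [12,11] [9,4,5,0] [1,3,8,10],
     .k [(3,6),(5,7)] [11,10,9,8,7] [4,3,2,1] [0,5,6,12],
     .k [(2,7)] [8,7,2] [4,5,0] [1,3,6,9],
     .k [(2,11),(4,7)] [10,9,0] [7,4,3,2] [1,5,8,11],
     .k [(1,10),(9,11)] [11,9] [7,6,5,4,3,2,1] [0,8,10,12],
     .c 1 9 [10,11,12],
     .k [(2,9),(5,12)] [12,5] [10,9,3,2] [0,1,4,11],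
     .k [(4,7),(8,11)] [11,8,7] [5,1,0] [4,6,9,12],
     .c 5 8 [6,7],
     .c 5 9 [6,7,8],
     .c 10 12 [11],
     .k [(7,9),(8,10)] [10,11,12,1] [7,6,5,4,3] [0,2,8,9],
     .k [(1,6),(2,11)] [11,10,9] [7,6,1] [0,2,8,12],
     .k [(1,7)] [11,10,9,5,0] [7,3,2,1] [4,6,8,12],
     .c 6 8 [7],
     .h [0,1,6,7,8,9,10,11,12,2,3,4,5],
     .c 6 9 [7,8],
     .k [(6,12)] [12,6] [10,8,9,0] [1,5,7,11],
     .k [(2,12),(4,7)] [11,10,9,0] [7,4,3,2] [1,5,8,12],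
     .c 1 10 [11,12],
     .k [(2,9),(8,11)] [11,12,1] [9] [0,2,8,10],
     .c 9 12 [10,11],
     .c 1 5 [2,3,4],
     .k [(4,10)] [11,10,4] [2,1,0] [3,5,9,12],
     .k [(4,6),(5,7)] [11,10,9,8,7] [4,3,2,1] [0,5,6,12],
     .k [(1,11),(3,12)] [10,9,8,7,6,5,4,3] [1] [0,2,11,12],
     .k [(1,8),(7,9)] [11,10,9] [6,5,4,3,2,1] [0,7,8,12],
     .k [(2,8)] [8,2] [6,4,5,0] [1,3,7,9],
     .k [(8,10),(9,11)] [11,12,1] [8,7,6,5,4,3] [0,2,9,10],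
     .k [(2,12),(7,10)] [12,11,10] [6,3,4,5,0] [1,2,7,9],
     .k [(2,11),(7,10)] [11,10] [6,5,1,0] [2,7,9,12]]
  | _, _, _ => []

theorem check4_true : check cfg4 certs4 = true := by decide +kernel

theorem check3_111 : check (cfg3 1 1 1) (certs3 1 1 1) = true := by decide +kernel

theorem check3_112 : check (cfg3 1 1 2) (certs3 1 1 2) = true := by decide +kernel

theorem check3_113 : check (cfg3 1 1 3) (certs3 1 1 3) = true := by decide +kernel

theorem check3_121 : check (cfg3 1 2 1) (certs3 1 2 1) = true := by decide +kernel

theorem check3_122 : check (cfg3 1 2 2) (certs3 1 2 2) = true := by decide +kernel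

theorem check3_123 : check (cfg3 1 2 3) (certs3 1 2 3) = true := by decide +kernel

theorem check3_131 : check (cfg3 1 3 1) (certs3 1 3 1) = true := by decide +kernel

theorem check3_132 : check (cfg3 1 3 2) (certs3 1 3 2) = true := by decide +kernel

theorem check3_133 : check (cfg3 1 3 3) (certs3 1 3 3) = true := by decide +kernel

theorem check3_211 : check (cfg3 2 1 1) (certs3 2 1 1) = true := by decide +kernel

theorem check3_212 : check (cfg3 2 1 2) (certs3 2 1 2) = true := by decide +kernel

theorem check3_213 : check (cfg3 2 1 3) (certs3 2 1 3) = true := by decide +kernel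

theorem check3_221 : check (cfg3 2 2 1) (certs3 2 2 1) = true := by decide +kernel

theorem check3_222 : check (cfg3 2 2 2) (certs3 2 2 2) = true := by decide +kernel

theorem check3_223 : check (cfg3 2 2 3) (certs3 2 2 3) = true := by decide +kernel

theorem check3_231 : check (cfg3 2 3 1) (certs3 2 3 1) = true := by decide +kernel

theorem check3_232 : check (cfg3 2 3 2) (certs3 2 3 2) = true := by decide +kernel

theorem check3_233 : check (cfg3 2 3 3) (certs3 2 3 3) = true := by decide +kernel

theorem check3_311 : check (cfg3 3 1 1) (certs3 3 1 1) = true := by decide +kernel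

theorem check3_312 : check (cfg3 3 1 2) (certs3 3 1 2) = true := by decide +kernel

theorem check3_313 : check (cfg3 3 1 3) (certs3 3 1 3) = true := by decide +kernel

theorem check3_321 : check (cfg3 3 2 1) (certs3 3 2 1) = true := by decide +kernel

theorem check3_322 : check (cfg3 3 2 2) (certs3 3 2 2) = true := by decide +kernel

theorem check3_323 : check (cfg3 3 2 3) (certs3 3 2 3) = true := by decide +kernel

theorem check3_331 : check (cfg3 3 3 1) (certs3 3 3 1) = true := by decide +kernel

theorem check3_332 : check (cfg3 3 3 2) (certs3 3 3 2) = true := by decide +kernel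

theorem check3_333 : check (cfg3 3 3 3) (certs3 3 3 3) = true := by decide +kernel

/-! ### Soundness of the DPLL procedure -/

/-- A clause holds for the valuation `v`. -/
def ClauseHolds (v : ℕ → Prop) (c : ℕ × ℕ) : Prop :=
  ∃ k, (c.1.testBit k = true ∧ v k) ∨ (c.2.testBit k = true ∧ ¬ v k)

/-- The result of a scan is correct for the valuation `v`. -/
def Scan.Good (v : ℕ → Prop) : Scan → Prop
  | .conflict => False
  | .unit p q => (∀ k, p.testBit k = true → v k) ∧ (∀ k, q.testBit k = true → ¬ v k)
  | .branch _ => True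
  | .none => True

theorem testBit_of_eq_two_pow {n i j : ℕ} (h : n = 2 ^ j) (hi : n.testBit i = true) : i = j := by
  rw [h, Nat.testBit_two_pow] at hi
  simpa using (of_decide_eq_true hi).symm

theorem scan_good (v : ℕ → Prop) (T F : ℕ) (hT : ∀ k, T.testBit k = true → v k)
    (hF : ∀ k, F.testBit k = true → ¬ v k) (cls : List (ℕ × ℕ)) :
    ∀ d : Scan, d.Good v → (∀ c ∈ cls, ClauseHolds v c) → (scan T F cls d).Good v := by
  induction cls with
  | nil => intro d hd _; simpa [scan] using hd
  | cons c t ih =>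
    obtain ⟨p, q⟩ := c
    intro d hd hc
    have ht : ∀ c ∈ t, ClauseHolds v c := fun c h => hc c (List.mem_cons_of_mem _ h)
    have h0 : ClauseHolds v (p, q) := hc _ List.mem_cons_self
    have key : ∃ k, ((p ^^^ (p &&& F)).testBit k = true ∧ v k) ∨
        ((q ^^^ (q &&& T)).testBit k = true ∧ ¬ v k) := by
      obtain ⟨k, hk | hk⟩ := h0
      · refine ⟨k, Or.inl ⟨?_, hk.2⟩⟩
        have : F.testBit k = false := by
          by_contra hne
          exact hF k (by simpa using hne) hk.2
        simpa [Nat.testBit_xor, Nat.testBit_and, this] using hk.1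
      · refine ⟨k, Or.inr ⟨?_, hk.2⟩⟩
        have : T.testBit k = false := by
          by_contra hne
          exact hk.2 (hT k (by simpa using hne))
        simpa [Nat.testBit_xor, Nat.testBit_and, this] using hk.1
    unfold scan
    split_ifs with h1
    · exact ih d hd ht
    · dsimp only
      generalize p ^^^ (p &&& F) = p' at key ⊢
      generalize q ^^^ (q &&& T) = q' at key ⊢
      split_ifs with h2 h3 h4 h5
      · simp only [beq_iff_eq] at h2 h3
        subst h2 h3
        simp at key
      · simp only [beq_iff_eq] at h2 h4
        subst h2
        refine ⟨by simp, fun k hk => ?_⟩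
        obtain ⟨k', hk' | hk'⟩ := key
        · simp at hk'
        · rw [testBit_of_eq_two_pow h4 hk, ← testBit_of_eq_two_pow h4 hk'.1]
          exact hk'.2
      · exact ih d hd ht
      · simp only [Bool.and_eq_true, beq_iff_eq] at h5
        obtain ⟨h5, h6⟩ := h5
        subst h5
        refine ⟨fun k hk => ?_, by simp⟩
        obtain ⟨k', hk' | hk'⟩ := key
        · rw [testBit_of_eq_two_pow h6 hk, ← testBit_of_eq_two_pow h6 hk'.1]
          exact hk'.2
        · simp at hk'
      · exact ih _ trivial ht

theorem dpll_sound (v : ℕ → Prop) (cls : List (ℕ × ℕ)) (hc : ∀ c ∈ cls, ClauseHolds v c) :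
    ∀ (f T F : ℕ), (∀ k, T.testBit k = true → v k) → (∀ k, F.testBit k = true → ¬ v k) →
      dpll cls f T F = false := by
  intro f
  induction f with
  | zero => intro T F _ _; rfl
  | succ f ih =>
    intro T F hT hF
    have hs := scan_good v T F hT hF cls .none trivial hc
    have ext : ∀ (A B : ℕ) (P : ℕ → Prop), (∀ k, A.testBit k = true → P k) →
        (∀ k, B.testBit k = true → P k) → ∀ k, (A ||| B).testBit k = true → P k := by
      intro A B P hA hB k hk
      rw [Nat.testBit_or, Bool.or_eq_true] at hk
      exact hk.elim (hA k) (hB k)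
    unfold dpll
    split
    · rename_i heq
      rw [heq] at hs
      exact hs.elim
    · rename_i p q heq
      rw [heq] at hs
      exact ih _ _ (ext _ _ _ hT hs.1) (ext _ _ _ hF hs.2)
    · rename_i k heq
      by_cases hk : v k
      · rw [ih (T ||| 2 ^ k) F (ext _ _ _ hT fun j hj => ?_) hF, Bool.false_and]
        rw [testBit_of_eq_two_pow rfl hj]
        exact hk
      · rw [ih T (F ||| 2 ^ k) hT (ext _ _ _ hF fun j hj => ?_), Bool.and_false]
        rw [testBit_of_eq_two_pow rfl hj]
        exact hk
    · rfl

theorem testBit_maskOf (l : List (ℕ × ℕ)) (k : ℕ) :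
    (maskOf l).testBit k = true ↔ ∃ p ∈ l, vx p.1 p.2 = k := by
  induction l with
  | nil => simp [maskOf]
  | cons p t ih =>
    rw [maskOf, Nat.testBit_or, Bool.or_eq_true, ih, Nat.testBit_two_pow]
    simp

/-! ### Soundness of the certificates -/

/-- A convenient form of 3-connectivity. -/
def Conn3 {V : Type*} (G : SimpleGraph V) : Prop :=
  4 ≤ Nat.card V ∧ ∀ (a b : V) (D : Set V), D.Nonempty → a ∉ D → b ∉ D →
    (∀ p ∈ D, ∀ q, G.Adj p q → q ∈ D ∨ q = a ∨ q = b) → ∀ e, e ∈ D ∨ e = a ∨ e = b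

/-- The list `l` is a hamilton cycle. -/
def HamL {V : Type*} (G : SimpleGraph V) (l : List V) : Prop :=
  l.Nodup ∧ (∀ v, v ∈ l) ∧ Cycle.Chain G.Adj (l : Cycle V)

/-- The `i`-th block. -/
def blkAt {V : Type*} (bl : List (List V)) (i : ℕ) : List V := bl.getD i []

/-- Some edge joins two blocks. -/
def EE {V : Type*} (G : SimpleGraph V) (bl : List (List V)) (i j : ℕ) : Prop :=
  ∃ x ∈ blkAt bl i, ∃ y ∈ blkAt bl j, G.Adj x y

/-- The blocks `bl` realize the configuration `g` in `G`. -/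
structure Realizes {V : Type*} (G : SimpleGraph V) (g : Cfg) (bl : List (List V)) : Prop where
  len : bl.length = g.n
  le : g.n ≤ 16
  lt : ∀ p ∈ g.t0 ++ g.f0, p.1 < g.n ∧ p.2 < g.n
  nd : bl.flatten.Nodup
  cov : ∀ v, v ∈ bl.flatten
  ne : ∀ b ∈ bl, b ≠ []
  ch : ∀ b ∈ bl, b.IsChain G.Adj
  sg : ∀ i ∈ g.sg, ∃ x, blkAt bl i = [x]
  t0 : ∀ p ∈ g.t0, EE G bl p.1 p.2
  f0 : ∀ p ∈ g.f0, ¬ EE G bl p.1 p.2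
  jn : ∀ p ∈ g.jn, ∀ x ∈ (blkAt bl p.1).getLast?, ∀ y ∈ (blkAt bl p.2).head?, G.Adj x y

section Soundness

variable {V : Type*} {G : SimpleGraph V} {g : Cfg} {bl : List (List V)}

theorem EE.symm {i j : ℕ} (h : EE G bl i j) : EE G bl j i := by
  obtain ⟨x, hx, y, hy, hxy⟩ := h
  exact ⟨y, hy, x, hx, hxy.symm⟩

/-- The valuation coming from blocks. -/
def vv (G : SimpleGraph V) (bl : List (List V)) (k : ℕ) : Prop := EE G bl (k / 16) (k % 16)

theorem vv_vx {a b : ℕ} (ha : a < 16) (hb : b < 16) : vv G bl (vx a b) ↔ EE G bl a b := by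
  unfold vv vx
  split_ifs with h
  · rw [show (16 * a + b) / 16 = a by omega, show (16 * a + b) % 16 = b by omega]
  · rw [show (16 * b + a) / 16 = b by omega, show (16 * b + a) % 16 = a by omega]
    exact ⟨EE.symm, EE.symm⟩

theorem okNodup_iff (l : List ℕ) : okNodup l = true ↔ l.Nodup := by
  induction l with
  | nil => simp [okNodup]
  | cons a t ih => simp [okNodup, ih]

theorem Realizes.mem (R : Realizes G g bl) {i : ℕ} (hi : i < g.n) : blkAt bl i ∈ bl := by
  have hi' : i < bl.length := by rw [R.len]; exact hi
  rw [blkAt, List.getD_eq_getElem _ _ hi']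
  exact List.getElem_mem hi'

theorem Realizes.range_map (R : Realizes G g bl) : (List.range g.n).map (blkAt bl) = bl := by
  apply List.ext_getElem
  · simp [R.len]
  · intro i h1 h2
    simp [blkAt, h2]

theorem Realizes.exists (R : Realizes G g bl) (v : V) : ∃ i < g.n, v ∈ blkAt bl i := by
  have := R.cov v
  rw [← R.range_map] at this
  simpa using this

theorem Realizes.uniq (R : Realizes G g bl) {i j : ℕ} (hi : i < g.n) (hj : j < g.n) {v : V}
    (h1 : v ∈ blkAt bl i) (h2 : v ∈ blkAt bl j) : i = j := by
  have hnd := R.nd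
  rw [← R.range_map, List.nodup_flatten, List.pairwise_map] at hnd
  by_contra hne
  have := hnd.2
  rw [List.pairwise_iff_getElem] at this
  rcases lt_or_gt_of_ne hne with h | h
  · have := this i j (by simpa using hi) (by simpa using hj) h
    simp only [List.getElem_range] at this
    exact this h1 h2
  · have := this j i (by simpa using hj) (by simpa using hi) h
    simp only [List.getElem_range] at this
    exact this h2 h1

/-- The union of some blocks. -/
def UU (bl : List (List V)) (r : List ℕ) : Set V := {v | ∃ i ∈ r, v ∈ blkAt bl i}

theorem chain_connected : ∀ l : List V, l ≠ [] → l.IsChain G.Adj →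
    (G.induce {v | v ∈ l}).Connected := by
  intro l
  induction l with
  | nil => intro h; exact absurd rfl h
  | cons x t ih =>
    intro _ hc
    cases t with
    | nil =>
      have : {v | v ∈ [x]} = ({x} : Set V) := by ext; simp
      rw [this]
      have : Nonempty ({x} : Set V) := ⟨⟨x, rfl⟩⟩
      have : Subsingleton ({x} : Set V) := ⟨fun a b => Subtype.ext (a.2.trans b.2.symm)⟩
      exact ⟨SimpleGraph.Preconnected.of_subsingleton⟩
    | cons y t =>
      rw [List.isChain_cons_cons] at hc
      have h2 := ih (by simp) hc.2
      have h1 : (G.induce ({x} : Set V)).Preconnected := by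
        have : Subsingleton ({x} : Set V) := ⟨fun a b => Subtype.ext (a.2.trans b.2.symm)⟩
        exact SimpleGraph.Preconnected.of_subsingleton
      have := SimpleGraph.connected_induce_union h1 h2.preconnected
        (Set.mem_singleton x) (show y ∈ {v | v ∈ y :: t} by simp) hc.1
      have e : {v | v ∈ x :: y :: t} = ({x} : Set V) ∪ {v | v ∈ y :: t} := by
        ext; simp
      rw [e]
      exact this

theorem Realizes.connB (R : Realizes G g bl) {i : ℕ} (hi : i < g.n) :
    (G.induce {v | v ∈ blkAt bl i}).Connected :=
  chain_connected _ (R.ne _ (R.mem hi)) (R.ch _ (R.mem hi))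

theorem Realizes.connU (R : Realizes G g bl) (adj : ℕ → ℕ → Bool)
    (hadj : ∀ i j, i < g.n → j < g.n → adj i j = true → EE G bl i j) :
    ∀ r : List ℕ, (∀ i ∈ r, i < g.n) → okConn adj r = true → (G.induce (UU bl r)).Connected := by
  intro r
  induction r with
  | nil => intro _ h; simp [okConn] at h
  | cons i t ih =>
    intro hr hok
    cases t with
    | nil =>
      have : UU bl [i] = {v | v ∈ blkAt bl i} := by ext; simp [UU]
      rw [this]
      exact R.connB (hr i (by simp))
    | cons j t =>
      simp only [okConn, Bool.and_eq_true] at hok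
      obtain ⟨h1, h2⟩ := hok
      rw [List.any_eq_true] at h1
      obtain ⟨k, hk, hik⟩ := h1
      obtain ⟨x, hx, y, hy, hxy⟩ := hadj i k (hr i (by simp)) (hr k (List.mem_cons_of_mem _ hk)) hik
      have hc := ih (fun a ha => hr a (List.mem_cons_of_mem _ ha)) h2
      have := SimpleGraph.connected_induce_union (R.connB (hr i (by simp))).preconnected
        hc.preconnected hx (show y ∈ UU bl (j :: t) from ⟨k, hk, hy⟩) hxy
      have e : UU bl (i :: j :: t) = {v | v ∈ blkAt bl i} ∪ UU bl (j :: t) := by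
        ext v; simp [UU]
      rw [e]
      exact this

theorem Realizes.disjU (R : Realizes G g bl) {r s : List ℕ} (hr : ∀ i ∈ r, i < g.n)
    (hs : ∀ i ∈ s, i < g.n) (hd : ∀ i ∈ r, i ∉ s) : Disjoint (UU bl r) (UU bl s) := by
  rw [Set.disjoint_left]
  rintro v ⟨i, hi, hv⟩ ⟨j, hj, hv'⟩
  have := R.uniq (hr i hi) (hs j hj) hv hv'
  subst this
  exact hd i hi hj

theorem Realizes.pmem_EE (R : Realizes G g bl) {ch : List (ℕ × ℕ)}
    (hch : ¬ ∃ k, (maskOf ch).testBit k = true ∧ ¬ vv G bl k) {i j : ℕ} (hi : i < g.n)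
    (hj : j < g.n) (h : pmem (g.t0 ++ ch) i j = true) : EE G bl i j := by
  have key : ∀ a b, a < g.n → b < g.n → (a, b) ∈ g.t0 ++ ch → EE G bl a b := by
    intro a b ha hb hm
    rcases List.mem_append.1 hm with hm | hm
    · exact R.t0 _ hm
    · by_contra hne
      refine hch ⟨vx a b, (testBit_maskOf _ _).2 ⟨(a, b), hm, rfl⟩, ?_⟩
      rw [vv_vx (ha.trans_le R.le) (hb.trans_le R.le)]
      exact hne
  rw [pmem, List.any_eq_true] at h
  obtain ⟨⟨a, b⟩, hm, hq⟩ := h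
  simp only [Bool.or_eq_true, Bool.and_eq_true, beq_iff_eq] at hq
  rcases hq with ⟨rfl, rfl⟩ | ⟨rfl, rfl⟩
  · exact key _ _ hi hj hm
  · exact (key _ _ hj hi hm).symm

theorem sound_k (R : Realizes G g bl) (hfree : MinorFree K24 G) {ch : List (ℕ × ℕ)}
    {r₁ r₂ s : List ℕ} (hok : (Cert.k ch r₁ r₂ s).ok g = true) :
    ClauseHolds (vv G bl) ((Cert.k ch r₁ r₂ s).clause g) := by
  by_contra hcl
  apply hfree
  have hch : ¬ ∃ k, (maskOf ch).testBit k = true ∧ ¬ vv G bl k := by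
    rintro ⟨k, hk⟩
    exact hcl ⟨k, Or.inr hk⟩
  have hE : ∀ i j, i < g.n → j < g.n → pmem (g.t0 ++ ch) i j = true → EE G bl i j :=
    fun i j hi hj h => R.pmem_EE hch hi hj h
  simp only [Cert.ok, Bool.and_eq_true, beq_iff_eq] at hok
  obtain ⟨⟨⟨⟨⟨h1, h2⟩, h3⟩, h4⟩, h5⟩, h6⟩ := hok
  have hlt : ∀ i ∈ r₁ ++ (r₂ ++ s), i < g.n := by
    simpa only [List.all_eq_true, decide_eq_true_eq] using h6
  have l1 : ∀ i ∈ r₁, i < g.n := fun i hi => hlt i (by simp [hi])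
  have l2 : ∀ i ∈ r₂, i < g.n := fun i hi => hlt i (by simp [hi])
  have l3 : ∀ i ∈ s, i < g.n := fun i hi => hlt i (by simp [hi])
  rw [okNodup_iff, List.nodup_append', List.nodup_append'] at h5
  obtain ⟨n1, ⟨n2, n3, d23⟩, d1⟩ := h5
  rw [List.all_eq_true] at h3
  have es : ∀ x ∈ s, (∃ v₁ ∈ UU bl r₁, ∃ v₂ ∈ UU bl [x], G.Adj v₁ v₂) ∧
      (∃ v₁ ∈ UU bl r₂, ∃ v₂ ∈ UU bl [x], G.Adj v₁ v₂) := by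
    intro x hx
    have := h3 x hx
    simp only [Bool.and_eq_true, List.any_eq_true] at this
    obtain ⟨⟨a, ha, ha'⟩, ⟨b, hb, hb'⟩⟩ := this
    obtain ⟨p, hp, q, hq, hpq⟩ := hE _ _ (l3 x hx) (l1 a ha) ha'
    obtain ⟨p', hp', q', hq', hpq'⟩ := hE _ _ (l3 x hx) (l2 b hb) hb'
    exact ⟨⟨q, ⟨a, ha, hq⟩, p, ⟨x, by simp, hp⟩, hpq.symm⟩,
      ⟨q', ⟨b, hb, hq'⟩, p', ⟨x, by simp, hp'⟩, hpq'.symm⟩⟩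
  have hget : ∀ j : Fin 4, s[j.1]'(by omega) ∈ s := fun j => List.getElem_mem _
  have lj : ∀ j : Fin 4, ∀ i ∈ [s[j.1]'(by omega)], i < g.n := by
    intro j i hi
    rw [List.mem_singleton] at hi
    rw [hi]
    exact l3 _ (hget j)
  have m23 : ∀ i ∈ s, i ∉ r₂ := fun i hi hi' => d23 hi' hi
  have m13 : ∀ i ∈ s, i ∉ r₁ := fun i hi hi' => d1 hi' (by simp [hi])
  have d12 : Disjoint (UU bl r₁) (UU bl r₂) :=
    R.disjU l1 l2 fun i hi hi' => d1 hi (by simp [hi'])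
  have dj1 : ∀ j : Fin 4, Disjoint (UU bl [s[j.1]'(by omega)]) (UU bl r₁) := fun j =>
    R.disjU (lj j) l1 fun i hi => by
      rw [List.mem_singleton] at hi
      rw [hi]
      exact m13 _ (hget j)
  have dj2 : ∀ j : Fin 4, Disjoint (UU bl [s[j.1]'(by omega)]) (UU bl r₂) := fun j =>
    R.disjU (lj j) l2 fun i hi => by
      rw [List.mem_singleton] at hi
      rw [hi]
      exact m23 _ (hget j)
  refine ⟨fun w => match w with
    | Sum.inl 0 => UU bl r₁
    | Sum.inl 1 => UU bl r₂
    | Sum.inr j => UU bl [s[j.1]'(by omega)], ?_, ?_, ?_⟩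
  · rintro (i | j)
    · fin_cases i
      · exact R.connU _ hE _ l1 h1
      · exact R.connU _ hE _ l2 h2
    · exact R.connU (fun _ _ => false) (by simp) _ (lj j) rfl
  · rintro (i | j) (i' | j') hne
    · fin_cases i <;> fin_cases i'
      · exact absurd rfl hne
      · exact d12
      · exact d12.symm
      · exact absurd rfl hne
    · fin_cases i
      · exact (dj1 j').symm
      · exact (dj2 j').symm
    · fin_cases i'
      · exact dj1 j
      · exact dj2 j
    · refine R.disjU (lj j) (lj j') fun i hi hi' => hne ?_
      rw [List.mem_singleton] at hi hi'
      have := (List.Nodup.getElem_inj_iff n3).1 (hi.symm.trans hi')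
      rw [Fin.ext this]
  · rintro (i | j) (i' | j') hadj
    · simp [K24] at hadj
    · fin_cases i
      · exact (es _ (hget j')).1
      · exact (es _ (hget j')).2
    · fin_cases i'
      · obtain ⟨a, ha, b, hb, hab⟩ := (es _ (hget j)).1
        exact ⟨b, hb, a, ha, hab.symm⟩
      · obtain ⟨a, ha, b, hb, hab⟩ := (es _ (hget j)).2
        exact ⟨b, hb, a, ha, hab.symm⟩
    · simp [K24] at hadj

theorem sound_c (R : Realizes G g bl) (h3 : Conn3 G) {a b : ℕ} {comp : List ℕ}
    (hok : (Cert.c a b comp).ok g = true) :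
    ClauseHolds (vv G bl) ((Cert.c a b comp).clause g) := by
  simp only [Cert.ok, Bool.and_eq_true, Bool.not_eq_true', List.elem_eq_mem, decide_eq_true_eq,
    decide_eq_false_iff_not, List.all_eq_true, List.any_eq_true, List.mem_range,
    beq_eq_false_iff_ne, ne_eq] at hok
  obtain ⟨⟨⟨⟨⟨⟨⟨⟨ha, hb⟩, hac⟩, hbc⟩, hne⟩, hlt⟩, han⟩, hbn⟩, y, hyn, ⟨hyc, hya⟩, hyb⟩ := hok
  by_contra hcl
  have hno : ∀ i ∈ comp, ∀ j < g.n, j ∉ comp → j ≠ a → j ≠ b → ¬ EE G bl i j := by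
    intro i hi j hj hjc hja hjb hE
    refine hcl ⟨vx i j, Or.inl ⟨?_, (vv_vx ((hlt i hi).trans_le R.le) (hj.trans_le R.le)).2 hE⟩⟩
    refine (testBit_maskOf _ _).2 ⟨(i, j), ?_, rfl⟩
    simp only [crossing, List.mem_flatMap, List.mem_map, List.mem_filter, List.mem_range]
    exact ⟨i, hi, j, ⟨hj, by simp [hjc, hja, hjb]⟩, rfl⟩
  obtain ⟨x, hx⟩ := R.sg a ha
  obtain ⟨z, hz⟩ := R.sg b hb
  have hxm : x ∈ blkAt bl a := by simp [hx]
  have hzm : z ∈ blkAt bl b := by simp [hz]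
  obtain ⟨e, he⟩ := List.exists_mem_of_ne_nil _ (R.ne _ (R.mem hyn))
  have hout : ∀ v i, i < g.n → i ∉ comp → v ∈ blkAt bl i → v ∉ UU bl comp := by
    rintro v i hi hic hv ⟨j, hj, hv'⟩
    exact hic (R.uniq hi (hlt j hj) hv hv' ▸ hj)
  have := h3.2 x z (UU bl comp) ?_ (hout x a han hac hxm) (hout z b hbn hbc hzm) ?_ e
  · rcases this with h | h | h
    · exact hout e y hyn hyc he h
    · exact hya (R.uniq hyn han he (h ▸ hxm))
    · exact hyb (R.uniq hyn hbn he (h ▸ hzm))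
  · cases comp with
    | nil => simp at hne
    | cons c t =>
      obtain ⟨e, he⟩ := List.exists_mem_of_ne_nil _ (R.ne _ (R.mem (hlt c (by simp))))
      exact ⟨e, c, by simp, he⟩
  · rintro p ⟨i, hi, hp⟩ q hpq
    obtain ⟨j, hj, hq⟩ := R.exists q
    by_cases hjc : j ∈ comp
    · exact Or.inl ⟨j, hjc, hq⟩
    · by_cases hja : j = a
      · subst hja
        rw [hx, List.mem_singleton] at hq
        exact Or.inr (Or.inl hq)
      · by_cases hjb : j = b
        · subst hjb
          rw [hz, List.mem_singleton] at hq
          exact Or.inr (Or.inr hq)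
        · exact absurd ⟨p, hp, q, hq, hpq⟩ (hno i hi j hj hjc hja hjb)

/-- An oriented block. -/
def oblk (bl : List (List V)) (x : ℕ) : List V :=
  if x < 20 then blkAt bl (lab x) else (blkAt bl (lab x)).reverse

theorem oblk_perm (x : ℕ) : (oblk bl x).Perm (blkAt bl (lab x)) := by
  unfold oblk
  split_ifs
  · exact List.Perm.refl _
  · exact List.reverse_perm _

theorem oblk_fwd (R : Realizes G g bl) {x : ℕ} (h : x < 20 ∨ lab x ∈ g.sg) :
    oblk bl x = blkAt bl (lab x) := by
  unfold oblk
  split_ifs with hx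
  · rfl
  · rcases h with h | h
    · exact absurd h hx
    · obtain ⟨a, ha⟩ := R.sg _ h
      rw [ha]; rfl

theorem oblk_bwd (R : Realizes G g bl) {x : ℕ} (h : 20 ≤ x ∨ lab x ∈ g.sg) :
    oblk bl x = (blkAt bl (lab x)).reverse := by
  unfold oblk
  split_ifs with hx
  · rcases h with h | h
    · omega
    · obtain ⟨a, ha⟩ := R.sg _ h
      rw [ha]; rfl
  · rfl

theorem step_sound (R : Realizes G g bl) {x y : ℕ} (h : stepOK g x y = true)
    (hE : bothS g x y = true → EE G bl (lab x) (lab y)) :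
    ∀ p ∈ (oblk bl x).getLast?, ∀ q ∈ (oblk bl y).head?, G.Adj p q := by
  simp only [stepOK, Bool.or_eq_true, Bool.and_eq_true, decide_eq_true_eq, List.elem_eq_mem,
    List.any_eq_true, beq_iff_eq] at h
  rcases h with (h | ⟨⟨hx, hy⟩, ⟨a, b⟩, hm, rfl, rfl⟩) | ⟨⟨hx, hy⟩, ⟨a, b⟩, hm, rfl, rfl⟩
  · obtain ⟨u, hu, w, hw, huw⟩ := hE h
    simp only [bothS, Bool.and_eq_true, List.elem_eq_mem, decide_eq_true_eq] at h
    rw [oblk_fwd R (Or.inr h.1), oblk_fwd R (Or.inr h.2)]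
    obtain ⟨p, hp⟩ := R.sg _ h.1
    obtain ⟨q, hq⟩ := R.sg _ h.2
    rw [hp] at hu ⊢
    rw [hq] at hw ⊢
    simp only [List.mem_singleton] at hu hw
    subst hu hw
    simpa using huw
  · rw [oblk_fwd R hx, oblk_fwd R hy]
    exact R.jn _ hm
  · rw [oblk_bwd R hx, oblk_bwd R hy, List.getLast?_reverse, List.head?_reverse]
    exact fun p hp q hq => (R.jn _ hm q hq p hp).symm

theorem okChain_sound (R : Realizes G g bl) : ∀ l : List ℕ, okChain g l = true →
    (∀ p ∈ chEdges g l, EE G bl p.1 p.2) →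
    (l.map (oblk bl)).IsChain (fun l₁ l₂ => ∀ x ∈ l₁.getLast?, ∀ y ∈ l₂.head?, G.Adj x y) := by
  intro l
  induction l with
  | nil => intro _ _; simp
  | cons x t ih =>
    cases t with
    | nil => intro _ _; simp
    | cons y t =>
      intro h hE
      simp only [okChain, Bool.and_eq_true] at h
      rw [List.map_cons, List.map_cons, List.isChain_cons_cons]
      refine ⟨step_sound R h.1 fun hb => hE (lab x, lab y) (by simp [chEdges, hb]), ?_⟩
      refine ih h.2 fun p hp => hE p ?_
      rw [chEdges]
      split_ifs
      · exact List.mem_cons_of_mem _ hp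
      · exact hp

theorem chEdges_lab : ∀ (l : List ℕ) (p : ℕ × ℕ), p ∈ chEdges g l →
    p.1 ∈ l.map lab ∧ p.2 ∈ l.map lab := by
  intro l
  induction l with
  | nil => intro p hp; simp [chEdges] at hp
  | cons x t ih =>
    cases t with
    | nil => intro p hp; simp [chEdges] at hp
    | cons y t =>
      intro p hp
      rw [chEdges] at hp
      have ih' := ih p
      rw [List.map_cons]
      split_ifs at hp
      · rcases List.mem_cons.1 hp with rfl | hp
        · simp
        · exact ⟨List.mem_cons_of_mem _ (ih' hp).1, List.mem_cons_of_mem _ (ih' hp).2⟩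
      · exact ⟨List.mem_cons_of_mem _ (ih' hp).1, List.mem_cons_of_mem _ (ih' hp).2⟩

theorem sound_h (R : Realizes G g bl) (hH : ¬ ∃ l, HamL G l) {l : List ℕ}
    (hok : (Cert.h l).ok g = true) : ClauseHolds (vv G bl) ((Cert.h l).clause g) := by
  by_contra hcl
  apply hH
  simp only [Cert.ok, Bool.and_eq_true, beq_iff_eq, okNodup_iff, List.all_eq_true,
    decide_eq_true_eq, List.elem_eq_mem] at hok
  obtain ⟨⟨⟨⟨⟨h0, hs⟩, hnd⟩, hlen⟩, hlt⟩, hch⟩ := hok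
  have h0n : 0 < g.n := by
    cases l with
    | nil => simp at h0
    | cons a t => rw [← hlen]; simp
  have hE : ∀ p ∈ chEdges g (l ++ [0]), EE G bl p.1 p.2 := by
    rintro ⟨a, b⟩ hp
    have hl : ∀ x ∈ (l ++ [0]).map lab, x < g.n := by
      intro x hx
      rw [List.map_append, List.mem_append] at hx
      rcases hx with hx | hx
      · exact hlt x hx
      · simp [lab] at hx
        omega
    have := chEdges_lab _ _ hp
    by_contra hne
    refine hcl ⟨vx a b, Or.inr ⟨(testBit_maskOf _ _).2 ⟨_, hp, rfl⟩, ?_⟩⟩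
    rw [vv_vx ((hl _ this.1).trans_le R.le) ((hl _ this.2).trans_le R.le)]
    exact hne
  have hc := okChain_sound R _ hch hE
  have hpl : (l.map lab).Perm (List.range g.n) := by
    refine (List.subperm_of_subset hnd ?_).perm_of_length_le (by simp [hlen])
    intro x hx
    exact List.mem_range.2 (hlt x hx)
  have hperm : ((l.map (oblk bl)).flatten).Perm bl.flatten := by
    have e1 : ((l.map (oblk bl)).flatten).Perm ((l.map lab).flatMap (blkAt bl)) := by
      rw [List.flatMap_map, ← List.flatMap_def]
      exact List.Perm.flatMap_left _ fun x _ => oblk_perm x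
    refine e1.trans ((hpl.flatMap_right _).trans ?_)
    rw [List.flatMap_def, R.range_map]
  have hmem : ∀ x ∈ (l ++ [0]).map (oblk bl), x ≠ [] ∧ x.IsChain G.Adj := by
    intro x hx
    obtain ⟨i, hi, rfl⟩ := List.mem_map.1 hx
    have hin : lab i < g.n := by
      rcases List.mem_append.1 hi with hi | hi
      · exact hlt _ (List.mem_map_of_mem hi)
      · rw [List.mem_singleton.1 hi]; exact h0n
    have hb := R.mem hin
    unfold oblk
    split_ifs
    · exact ⟨R.ne _ hb, R.ch _ hb⟩
    · refine ⟨by simpa using R.ne _ hb, ?_⟩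
      rw [List.isChain_reverse]
      exact (R.ch _ hb).imp fun _ _ h => h.symm
  have hfl : ((l ++ [0]).map (oblk bl)).flatten.IsChain G.Adj :=
    (List.isChain_flatten fun h => (hmem _ h).1 rfl).2 ⟨fun x hx => (hmem x hx).2, hc⟩
  refine ⟨(l.map (oblk bl)).flatten, hperm.nodup_iff.2 R.nd, fun v => hperm.mem_iff.2 (R.cov v), ?_⟩
  cases l with
  | nil => simp at h0
  | cons a t =>
    simp only [List.head?_cons, Option.some.injEq] at h0
    subst h0
    obtain ⟨x, hx⟩ := R.sg 0 hs
    have ho : oblk bl 0 = [x] := by simpa [oblk, lab] using hx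
    simp only [List.cons_append, List.map_cons, List.map_append, List.map_nil, ho,
      List.flatten_cons, List.flatten_append, List.flatten_nil, List.append_nil,
      List.nil_append] at hfl ⊢
    rw [Cycle.chain_coe_cons]
    exact hfl

theorem sound (R : Realizes G g bl) (h3 : Conn3 G) (hfree : MinorFree K24 G)
    (hH : ¬ ∃ l, HamL G l) {cs : List Cert} (hc : check g cs = true) : False := by
  rw [check, Bool.and_eq_true, List.all_eq_true] at hc
  have hT : ∀ k, (maskOf g.t0).testBit k = true → vv G bl k := by
    intro k hk
    obtain ⟨p, hp, rfl⟩ := (testBit_maskOf _ _).1 hk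
    have := R.lt p (by simp [hp])
    exact (vv_vx (this.1.trans_le R.le) (this.2.trans_le R.le)).2 (R.t0 p hp)
  have hF : ∀ k, (maskOf g.f0).testBit k = true → ¬ vv G bl k := by
    intro k hk
    obtain ⟨p, hp, rfl⟩ := (testBit_maskOf _ _).1 hk
    have := R.lt p (by simp [hp])
    rw [vv_vx (this.1.trans_le R.le) (this.2.trans_le R.le)]
    exact R.f0 p hp
  have := dpll_sound (vv G bl) (cs.map fun c => c.clause g) ?_ 200 _ _ hT hF
  · rw [this] at hc
    exact absurd hc.2 (by simp)
  · intro c hcm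
    obtain ⟨c, hcc, rfl⟩ := List.mem_map.1 hcm
    have hok := hc.1 c hcc
    cases c with
    | k ch r₁ r₂ s => exact sound_k R hfree hok
    | h l => exact sound_h R hH hok
    | c a b comp => exact sound_c R h3 hok

end Soundness

/-! ### Contractions in 3-connected graphs -/

section Contraction

variable {V : Type*} {G : SimpleGraph V}

theorem conn3_of_KConnected [Finite V] (h : KConnected 3 G) : Conn3 G := by
  refine ⟨h.1, fun a b D hD ha hb hcl e => ?_⟩
  by_contra! he
  have hS : ({a, b} : Set V).ncard < 3 :=
    (Set.ncard_insert_le a {b}).trans_lt (by simp)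
  have hc := (h.2 {a, b} hS).preconnected
  obtain ⟨d, hd⟩ := hD
  have hd' : d ∈ ({a, b} : Set V)ᶜ := by
    rintro (rfl | rfl)
    · exact ha hd
    · exact hb hd
  have he' : e ∈ ({a, b} : Set V)ᶜ := by
    rintro (h | h)
    · exact he.2.1 h
    · exact he.2.2 h
  obtain ⟨w⟩ := hc ⟨d, hd'⟩ ⟨e, he'⟩
  have key : ∀ (p q : (({a, b} : Set V)ᶜ : Set V)),
      (G.induce ({a, b} : Set V)ᶜ).Walk p q → p.1 ∈ D → q.1 ∈ D := by
    intro p q w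
    induction w with
    | nil => exact id
    | cons hadj _ ih =>
      rename_i u v w' _
      intro hp
      apply ih
      rcases hcl _ hp _ hadj with h | h | h
      · exact h
      · exact absurd (Or.inl h) v.2
      · exact absurd (Or.inr h) v.2
  exact he.1 (key _ _ w hd)

/-- Contraction of `y` into `x`. -/
def ctr (G : SimpleGraph V) (x y : V) : SimpleGraph {v // v ≠ y} where
  Adj a b := a ≠ b ∧ (G.Adj a b ∨ (a.1 = x ∧ G.Adj y b) ∨ (b.1 = x ∧ G.Adj a y))
  symm := ⟨by
    rintro a b ⟨h1, h2 | h2 | h2⟩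
    · exact ⟨h1.symm, Or.inl h2.symm⟩
    · exact ⟨h1.symm, Or.inr (Or.inr ⟨h2.1, h2.2.symm⟩)⟩
    · exact ⟨h1.symm, Or.inr (Or.inl ⟨h2.1, h2.2.symm⟩)⟩⟩
  loopless := ⟨fun a h => h.1 rfl⟩

/-- A set `D` separated from the rest by `x`, `y`, `z`. -/
def Frag (G : SimpleGraph V) (x y z : V) (D : Set V) : Prop :=
  D.Nonempty ∧ x ∉ D ∧ y ∉ D ∧ z ∉ D ∧
    (∀ p ∈ D, ∀ q, G.Adj p q → q ∈ D ∨ q = x ∨ q = y ∨ q = z) ∧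
    ∃ e, e ∉ D ∧ e ≠ x ∧ e ≠ y ∧ e ≠ z

theorem frag_of_ctr_aux {x y : V} {b : {v // v ≠ y}} {D : Set {v // v ≠ y}} (hD : D.Nonempty)
    (hx : ∀ h, (⟨x, h⟩ : {v // v ≠ y}) ∉ D) (hb : b ∉ D)
    (hcl : ∀ p ∈ D, ∀ q, (ctr G x y).Adj p q → q ∈ D ∨ q.1 = x ∨ q = b)
    {e : {v // v ≠ y}} (he : e ∉ D) (hex : e.1 ≠ x) (heb : e ≠ b) :
    Frag G x y b.1 (Subtype.val '' D) := by
  refine ⟨hD.image _, ?_, ?_, ?_, ?_, e.1, ?_, hex, e.2, fun h => heb (Subtype.ext h)⟩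
  · rintro ⟨a, ha, rfl⟩
    exact hx a.2 ha
  · rintro ⟨a, ha, h⟩
    exact a.2 h
  · rintro ⟨a, ha, h⟩
    exact hb (Subtype.ext h ▸ ha)
  · rintro _ ⟨p, hp, rfl⟩ q hpq
    by_cases hq : q = y
    · exact Or.inr (Or.inr (Or.inl hq))
    · have := hcl p hp ⟨q, hq⟩ ⟨fun h => hpq.ne (congrArg Subtype.val h), Or.inl hpq⟩
      rcases this with h | h | h
      · exact Or.inl ⟨_, h, rfl⟩
      · exact Or.inr (Or.inl h)
      · exact Or.inr (Or.inr (Or.inr (congrArg Subtype.val h)))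
  · rintro ⟨a, ha, h⟩
    exact he (Subtype.ext h ▸ ha)

theorem frag_of_not_conn3 [Finite V] (h3 : Conn3 G) (hcard : 5 ≤ Nat.card V) {x y : V}
    (hxy : G.Adj x y) (hn : ¬ Conn3 (ctr G x y)) : ∃ z D, Frag G x y z D := by
  have hc : 4 ≤ Nat.card {v // v ≠ y} := by
    have h1 : Nat.card {v // v ≠ y} = ({y}ᶜ : Set V).ncard := Nat.card_coe_set_eq _
    have h2 := Set.ncard_add_ncard_compl ({y} : Set V)
    rw [Set.ncard_singleton] at h2
    omega
  have hn' := fun h => hn ⟨hc, h⟩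
  clear hn
  by_contra hno
  apply hn'
  intro a b D hD ha hb hcl e
  by_contra! he
  by_cases hax : a.1 = x
  · refine hno ⟨b.1, _, frag_of_ctr_aux (b := b) (e := e) hD (fun h => ?_) hb ?_ he.1 ?_ he.2.2⟩
    · have : (⟨x, h⟩ : {v // v ≠ y}) = a := Subtype.ext hax.symm
      rw [this]; exact ha
    · intro p hp q hpq
      rcases hcl p hp q hpq with h | h | h
      · exact Or.inl h
      · exact Or.inr (Or.inl (h ▸ hax))
      · exact Or.inr (Or.inr h)
    · intro h
      exact he.2.1 (Subtype.ext (h.trans hax.symm))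
  by_cases hbx : b.1 = x
  · refine hno ⟨a.1, _, frag_of_ctr_aux (b := a) (e := e) hD (fun h => ?_) ha ?_ he.1 ?_ he.2.1⟩
    · have : (⟨x, h⟩ : {v // v ≠ y}) = b := Subtype.ext hbx.symm
      rw [this]; exact hb
    · intro p hp q hpq
      rcases hcl p hp q hpq with h | h | h
      · exact Or.inl h
      · exact Or.inr (Or.inr h)
      · exact Or.inr (Or.inl (h ▸ hbx))
    · intro h
      exact he.2.2 (Subtype.ext (h.trans hbx.symm))
  let D' : Set V := {v | (∃ h : v ≠ y, ⟨v, h⟩ ∈ D) ∨ (v = y ∧ ⟨x, hxy.ne⟩ ∈ D)}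
  have hxab : ∀ {q : {v // v ≠ y}}, q.1 = x → q ∈ D ∨ q = a ∨ q = b → ⟨x, hxy.ne⟩ ∈ D := by
    rintro ⟨q, hq⟩ rfl (h | rfl | rfl)
    · exact h
    · exact absurd rfl hax
    · exact absurd rfl hbx
  have lift : ∀ {q : {v // v ≠ y}}, q ∈ D ∨ q = a ∨ q = b → q.1 ∈ D' ∨ q.1 = a.1 ∨ q.1 = b.1 := by
    rintro q (h | rfl | rfl)
    · exact Or.inl (Or.inl ⟨q.2, h⟩)
    · exact Or.inr (Or.inl rfl)
    · exact Or.inr (Or.inr rfl)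
  have := h3.2 a.1 b.1 D' ?_ ?_ ?_ ?_ e.1
  · rcases this with (⟨h, h'⟩ | h) | h | h
    · exact he.1 h'
    · exact e.2 h.1
    · exact he.2.1 (Subtype.ext h)
    · exact he.2.2 (Subtype.ext h)
  · obtain ⟨d, hd⟩ := hD
    exact ⟨d.1, Or.inl ⟨d.2, hd⟩⟩
  · rintro (⟨h, h'⟩ | h)
    · exact ha h'
    · exact a.2 h.1
  · rintro (⟨h, h'⟩ | h)
    · exact hb h'
    · exact b.2 h.1
  · rintro p (⟨hpy, hp⟩ | ⟨rfl, hx⟩) q hpq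
    · by_cases hq : q = y
      · subst hq
        by_cases hpx : p = x
        · subst hpx
          exact Or.inl (Or.inr ⟨rfl, hp⟩)
        · refine Or.inl (Or.inr ⟨rfl, hxab rfl (hcl _ hp ⟨x, hxy.ne⟩ ⟨?_, ?_⟩)⟩)
          · exact fun h => hpx (congrArg Subtype.val h)
          · exact Or.inr (Or.inr ⟨rfl, hpq⟩)
      · exact lift (hcl _ hp ⟨q, hq⟩ ⟨fun h => hpq.ne (congrArg Subtype.val h), Or.inl hpq⟩)
    · by_cases hqx : q = x
      · subst hqx
        exact Or.inl (Or.inl ⟨hxy.ne, hx⟩)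
      · refine lift (hcl _ hx ⟨q, hpq.ne'⟩ ⟨fun h => hqx (congrArg Subtype.val h).symm, ?_⟩)
        exact Or.inr (Or.inl ⟨rfl, hpq⟩)

theorem card_le_three [Finite V] {a b c : V} (h : ∀ e, e = a ∨ e = b ∨ e = c) :
    Nat.card V ≤ 3 := by
  rw [← Set.ncard_univ]
  have h1 : (Set.univ : Set V) ⊆ {a, b, c} := fun e _ => h e
  refine (Set.ncard_le_ncard h1).trans ((Set.ncard_insert_le _ _).trans ?_)
  have := Set.ncard_insert_le b ({c} : Set V)
  rw [Set.ncard_singleton] at this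
  omega

theorem exists_nbr [Finite V] (h3 : Conn3 G) {h a b : V} (ha : a ≠ h) (hb : b ≠ h) :
    ∃ c, G.Adj h c ∧ c ≠ a ∧ c ≠ b := by
  by_contra! hno
  have := h3.2 a b {h} ⟨h, rfl⟩ ha hb ?_
  · have := card_le_three this
    have := h3.1
    omega
  · rintro p rfl q hq
    by_contra! hne
    exact hne.2.2 (hno q hq hne.2.1)

theorem exists_ne_of_conn3 [Finite V] (h3 : Conn3 G) (h : V) : ∃ a, a ≠ h := by
  by_contra! hno
  have := card_le_three (a := h) (b := h) (c := h) fun e => Or.inl (hno e)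
  have := h3.1
  omega

theorem exists_contraction [Finite V] (h3 : Conn3 G) (hcard : 5 ≤ Nat.card V) :
    ∃ x y, G.Adj x y ∧ Conn3 (ctr G x y) := by
  by_contra! hno
  have hfr : ∀ x y, G.Adj x y → ∃ z D, Frag G x y z D := fun x y hxy =>
    frag_of_not_conn3 h3 hcard hxy (hno x y hxy)
  have hex : ∃ n, ∃ x y z D, G.Adj x y ∧ Frag G x y z D ∧ D.ncard = n := by
    have : Nonempty V := by
      by_contra hne
      rw [not_nonempty_iff] at hne
      rw [Nat.card_of_isEmpty] at hcard
      omega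
    obtain ⟨v⟩ := this
    obtain ⟨a, ha⟩ := exists_ne_of_conn3 h3 v
    obtain ⟨c, hc, _⟩ := exists_nbr h3 ha ha
    obtain ⟨z, D, hD⟩ := hfr v c hc
    exact ⟨_, v, c, z, D, hc, hD, rfl⟩
  classical
  obtain ⟨x, y, z, D, hxy, hF, hn⟩ := Nat.find_spec hex
  have hmin : ∀ x' y' z' D', G.Adj x' y' → Frag G x' y' z' D' → D.ncard ≤ D'.ncard := by
    intro x' y' z' D' h1 h2
    rw [hn]
    exact Nat.find_min' hex ⟨x', y', z', D', h1, h2, rfl⟩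
  obtain ⟨hDne, hxD, hyD, hzD, hcl, e, heD, hex', hey, hez⟩ := hF
  obtain ⟨v, hv, hzv⟩ : ∃ v ∈ D, G.Adj z v := by
    by_contra! hno
    have hh := h3.2 x y D hDne hxD hyD ?_ e
    · rcases hh with h | h | h
      · exact heD h
      · exact hex' h
      · exact hey h
    · intro p hp q hpq
      rcases hcl p hp q hpq with h | h | h | h
      · exact Or.inl h
      · exact Or.inr (Or.inl h)
      · exact Or.inr (Or.inr h)
      · exact absurd (h ▸ hpq).symm (hno p hp)
  obtain ⟨w, D', hF', hxD', hyD'⟩ : ∃ w D', Frag G z v w D' ∧ x ∉ D' ∧ y ∉ D' := by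
    obtain ⟨w, D₁, hF₁⟩ := hfr z v hzv
    obtain ⟨⟨d, hd⟩, hz1, hv1, hw1, hcl1, e1, he1, he2, he3, he4⟩ := hF₁
    by_cases hxy1 : x ∉ D₁ ∧ y ∉ D₁
    · exact ⟨w, D₁, ⟨⟨d, hd⟩, hz1, hv1, hw1, hcl1, e1, he1, he2, he3, he4⟩, hxy1⟩
    · refine ⟨w, {q | q ∉ D₁ ∧ q ≠ z ∧ q ≠ v ∧ q ≠ w},
        ⟨⟨e1, he1, he2, he3, he4⟩, ?_, ?_, ?_, ?_, d, ?_, ?_, ?_, ?_⟩, ?_, ?_⟩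
      · exact fun h => h.2.1 rfl
      · exact fun h => h.2.2.1 rfl
      · exact fun h => h.2.2.2 rfl
      · rintro p ⟨hp1, hp2, hp3, hp4⟩ q hpq
        by_contra! hq
        refine hq.1 ⟨fun hq1 => ?_, hq.2⟩
        rcases hcl1 q hq1 p hpq.symm with h | h | h | h
        · exact hp1 h
        · exact hp2 h
        · exact hp3 h
        · exact hp4 h
      · exact fun h => h.1 hd
      · rintro rfl; exact hz1 hd
      · rintro rfl; exact hv1 hd
      · rintro rfl; exact hw1 hd
      · rintro ⟨hx1, hx2, hx3, hx4⟩
        apply hxy1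
        refine ⟨hx1, fun hy1 => ?_⟩
        rcases hcl1 y hy1 x hxy.symm with h | h | h | h
        · exact hx1 h
        · exact hx2 h
        · exact hx3 h
        · exact hx4 h
      · rintro ⟨hx1, hx2, hx3, hx4⟩
        apply hxy1
        refine ⟨fun hy1 => ?_, hx1⟩
        rcases hcl1 x hy1 y hxy with h | h | h | h
        · exact hx1 h
        · exact hx2 h
        · exact hx3 h
        · exact hx4 h
  obtain ⟨hDne', hz', hv', hw', hcl', e', he1, he2, he3, he4⟩ := hF'
  obtain ⟨p, hp, hvp⟩ : ∃ p ∈ D', G.Adj v p := by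
    by_contra! hno
    have hh := h3.2 z w D' hDne' hz' hw' ?_ e'
    · rcases hh with h | h | h
      · exact he1 h
      · exact he2 h
      · exact he4 h
    · intro p hp q hpq
      rcases hcl' p hp q hpq with h | h | h | h
      · exact Or.inl h
      · exact Or.inr (Or.inl h)
      · exact absurd (h ▸ hpq).symm (hno p hp)
      · exact Or.inr (Or.inr h)
  have hpD : p ∈ D := by
    rcases hcl v hv p hvp with h | h | h | h
    · exact h
    · exact absurd (h ▸ hp) hxD'
    · exact absurd (h ▸ hp) hyD'
    · exact absurd (h ▸ hp) hz'
  have := hmin z v w (D ∩ D') hzv ⟨⟨p, hpD, hp⟩, fun h => hz' h.2, fun h => hv' h.2,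
    fun h => hw' h.2, ?_, e', fun h => he1 h.2, he2, he3, he4⟩
  · have hlt : (D ∩ D').ncard < D.ncard :=
      Set.ncard_lt_ncard ⟨Set.inter_subset_left, fun h => hv' (h hv).2⟩
    omega
  · rintro p ⟨hp1, hp2⟩ q hpq
    rcases hcl' p hp2 q hpq with h | h
    · left
      refine ⟨?_, h⟩
      rcases hcl p hp1 q hpq with h' | h' | h' | h'
      · exact h'
      · exact absurd (h' ▸ h) hxD'
      · exact absurd (h' ▸ h) hyD'
      · exact absurd (h' ▸ h) hz'
    · exact Or.inr h

theorem connected_lift {α β : Type*} {H : SimpleGraph α} {K : SimpleGraph β} (hH : H.Connected)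
    (f : α → β) (h1 : ∀ a b, H.Adj a b → K.Reachable (f a) (f b))
    (h2 : ∀ b, ∃ a, K.Reachable (f a) b) : K.Connected := by
  have key : ∀ a b, H.Walk a b → K.Reachable (f a) (f b) := by
    intro a b w
    induction w with
    | nil => exact SimpleGraph.Reachable.refl _
    | cons h _ ih => exact (h1 _ _ h).trans ih
  have : Nonempty β := hH.nonempty.map f
  refine ⟨fun b c => ?_⟩
  obtain ⟨a, ha⟩ := h2 b
  obtain ⟨a', ha'⟩ := h2 c
  obtain ⟨w⟩ := hH.preconnected a a'
  exact ha.symm.trans ((key _ _ w).trans ha')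

theorem minorFree_ctr {W : Type*} {H : SimpleGraph W} {x y : V} (hxy : G.Adj x y)
    (hfree : MinorFree H G) : MinorFree H (ctr G x y) := by
  rintro ⟨B, hc, hd, he⟩
  apply hfree
  have hxy' : x ≠ y := hxy.ne
  let B' : W → Set V := fun w => {v | (∃ h : v ≠ y, ⟨v, h⟩ ∈ B w) ∨ (v = y ∧ ⟨x, hxy'⟩ ∈ B w)}
  have hyB : ∀ w (a : {v // v ≠ y}), a ∈ B w → a.1 = x → y ∈ B' w := by
    rintro w ⟨a, ha⟩ h rfl
    exact Or.inr ⟨rfl, h⟩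
  have hB : ∀ w (a : {v // v ≠ y}), a ∈ B w → a.1 ∈ B' w := fun w a h => Or.inl ⟨a.2, h⟩
  refine ⟨B', fun w => ?_, fun w₁ w₂ hne => ?_, fun w₁ w₂ hadj => ?_⟩
  · refine connected_lift (hc w) (fun a => ⟨a.1.1, hB w _ a.2⟩) ?_ ?_
    · rintro ⟨a, ha⟩ ⟨b, hb⟩ ⟨-, h | ⟨h1, h2⟩ | ⟨h1, h2⟩⟩
      · exact SimpleGraph.Adj.reachable (G := G.induce (B' w)) h
      · have hy := hyB w a ha h1
        have r1 : (G.induce (B' w)).Adj ⟨a.1, hB w _ ha⟩ ⟨y, hy⟩ := by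
          change G.Adj a.1 y
          rw [show a.1 = x from h1]; exact hxy
        have r2 : (G.induce (B' w)).Adj ⟨y, hy⟩ ⟨b.1, hB w _ hb⟩ := h2
        exact r1.reachable.trans r2.reachable
      · have hy := hyB w b hb h1
        have r1 : (G.induce (B' w)).Adj ⟨y, hy⟩ ⟨b.1, hB w _ hb⟩ := by
          change G.Adj y b.1
          rw [show b.1 = x from h1]; exact hxy.symm
        have r2 : (G.induce (B' w)).Adj ⟨a.1, hB w _ ha⟩ ⟨y, hy⟩ := h2
        exact r2.reachable.trans r1.reachable
    · rintro ⟨b, ⟨hb, hb'⟩ | ⟨rfl, hb⟩⟩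
      · exact ⟨⟨⟨b, hb⟩, hb'⟩, SimpleGraph.Reachable.refl _⟩
      · refine ⟨⟨⟨x, hxy'⟩, hb⟩, SimpleGraph.Adj.reachable ?_⟩
        exact hxy
  · have hd' := Set.disjoint_left.1 (hd w₁ w₂ hne)
    rw [Set.disjoint_left]
    rintro v (⟨h, h1⟩ | ⟨h, h1⟩) (⟨h', h2⟩ | ⟨h', h2⟩)
    · exact hd' h1 h2
    · exact h h'
    · exact h' h
    · exact hd' h1 h2
  · obtain ⟨a, ha, b, hb, -, h | ⟨h1, h2⟩ | ⟨h1, h2⟩⟩ := he w₁ w₂ hadj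
    · exact ⟨a.1, hB _ _ ha, b.1, hB _ _ hb, h⟩
    · exact ⟨y, hyB _ _ ha h1, b.1, hB _ _ hb, h2⟩
    · exact ⟨a.1, hB _ _ ha, y, hyB _ _ hb h1, h2⟩

end Contraction

/-! ### Cycles missing one vertex -/

section Near

variable {V : Type*} {G : SimpleGraph V}

/-- The list `c` is a cycle through all vertices but `h`. -/
def Near (G : SimpleGraph V) (h : V) (c : List V) : Prop :=
  c.Nodup ∧ (∀ v, v ∈ c ↔ v ≠ h) ∧ Cycle.Chain G.Adj (c : Cycle V)

theorem Near.rot {h : V} {c c' : List V} (hc : Near G h c) (hr : c ~r c') : Near G h c' := by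
  refine ⟨hr.nodup_iff.1 hc.1, fun v => ?_, ?_⟩
  · rw [← hr.mem_iff]; exact hc.2.1 v
  · rw [← Cycle.coe_eq_coe.2 hr]; exact hc.2.2

theorem Near.no_consec (hH : ¬ ∃ l, HamL G l) {h a b : V} {Q : List V}
    (hc : Near G h (b :: Q ++ [a])) (ha : G.Adj h a) (hb : G.Adj h b) : False := by
  obtain ⟨h1, h2, h3⟩ := hc
  apply hH
  refine ⟨h :: (b :: Q ++ [a]), ?_, ?_, ?_⟩
  · rw [List.nodup_cons]
    exact ⟨fun hm => (h2 h).1 hm rfl, h1⟩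
  · intro v
    by_cases hv : v = h
    · simp [hv]
    · exact List.mem_cons_of_mem _ ((h2 v).2 hv)
  · rw [Cycle.chain_coe_cons]
    rw [List.cons_append, Cycle.chain_coe_cons] at h3
    have h4 : (b :: Q ++ [a]).IsChain G.Adj := by
      have : (b :: ((Q ++ [a]) ++ [b])) = (b :: Q ++ [a]) ++ [b] := by simp
      rw [this] at h3
      exact h3.left_of_append
    simp only [List.cons_append, List.append_assoc] at h4 ⊢
    rw [List.isChain_cons_cons]
    refine ⟨hb, ?_⟩
    have : b :: (Q ++ a :: ([] ++ [h])) = (b :: Q ++ [a]) ++ [h] := by simp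
    rw [this, List.isChain_append]
    refine ⟨h4, by simp, ?_⟩
    intro x hx y hy
    rw [List.getLast?_append] at hx
    simp at hx hy
    subst hx hy
    exact ha.symm

theorem split_first (P : V → Prop) : ∀ t : List V, (∃ x ∈ t, P x) →
    ∃ S u t', t = S ++ u :: t' ∧ (∀ x ∈ S, ¬ P x) ∧ P u := by
  intro t
  induction t with
  | nil => rintro ⟨x, hx, _⟩; simp at hx
  | cons a t ih =>
    intro h
    by_cases ha : P a
    · exact ⟨[], a, t, rfl, by simp, ha⟩
    · obtain ⟨x, hx, hp⟩ := h
      rcases List.mem_cons.1 hx with rfl | hx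
      · exact absurd hp ha
      · obtain ⟨S, u, t', rfl, h1, h2⟩ := ih ⟨x, hx, hp⟩
        refine ⟨a :: S, u, t', rfl, ?_, h2⟩
        intro y hy
        rcases List.mem_cons.1 hy with rfl | hy
        · exact ha
        · exact h1 y hy

theorem realize {h u : V} {rest : List (List V)} (hne : [] ∉ rest)
    (hc : Near G h (u :: rest.flatten)) {g : Cfg} (hn : g.n = rest.length + 2) (hle : g.n ≤ 16)
    (hlt : ∀ p ∈ g.t0 ++ g.f0, p.1 < g.n ∧ p.2 < g.n) (hjn : g.jn = cyJn g.n)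
    {hs : List (ℕ × ℕ)} (ht0 : g.t0 = cyJn g.n ++ hs)
    (hhs : ∀ p ∈ hs, EE G ([h] :: [u] :: rest) p.1 p.2)
    (hf0 : ∀ p ∈ g.f0, ¬ EE G ([h] :: [u] :: rest) p.1 p.2)
    (hsg : ∀ i ∈ g.sg, ∃ x, blkAt ([h] :: [u] :: rest) i = [x]) :
    Realizes G g ([h] :: [u] :: rest) := by
  obtain ⟨h1, h2, h3⟩ := hc
  rw [Cycle.chain_coe_cons] at h3
  have e : u :: (rest.flatten ++ [u]) = ([u] :: (rest ++ [[u]])).flatten := by simp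
  have hne' : [] ∉ [u] :: (rest ++ [[u]]) := by simp [hne]
  rw [e, List.isChain_flatten hne'] at h3
  obtain ⟨hb, hj⟩ := h3
  have hneB : ∀ b ∈ [h] :: [u] :: rest, b ≠ [] := by
    intro b hb he
    subst he
    simp [hne] at hb
  have aux : ∀ (i : ℕ) (hi : i ≤ rest.length), blkAt ([h] :: [u] :: rest) (i + 1) =
      ([u] :: (rest ++ [[u]]))[i]'(by simp; omega) := by
    intro i hi
    rw [blkAt, List.getD_eq_getElem _ _ (by simp; omega)]
    rw [List.getElem_cons_succ]
    cases i with
    | zero => simp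
    | succ k =>
      simp only [List.getElem_cons_succ]
      rw [List.getElem_append_left (by omega)]
  have hJ : ∀ p ∈ cyJn g.n, ∀ x ∈ (blkAt ([h] :: [u] :: rest) p.1).getLast?,
      ∀ y ∈ (blkAt ([h] :: [u] :: rest) p.2).head?, G.Adj x y := by
    rw [List.isChain_iff_getElem] at hj
    have hlast := hj rest.length (by simp)
    intro p hp
    rw [cyJn, List.mem_cons, List.mem_map] at hp
    rcases hp with rfl | ⟨i, hi, rfl⟩
    · have e1 : blkAt ([h] :: [u] :: rest) (g.n - 1) =
          ([u] :: (rest ++ [[u]]))[rest.length]'(by simp) := by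
        have h5 : g.n - 1 = rest.length + 1 := by omega
        rw [h5, aux _ le_rfl]
      have e2 : blkAt ([h] :: [u] :: rest) 1 =
          ([u] :: (rest ++ [[u]]))[rest.length + 1]'(by simp) := by
        simp [blkAt]
      simp only [e1, e2]
      exact hlast
    · rw [List.mem_range] at hi
      have hh := hj i (by simp; omega)
      have e1 : blkAt ([h] :: [u] :: rest) (i + 1) =
          ([u] :: (rest ++ [[u]]))[i]'(by simp; omega) := aux _ (by omega)
      have e2 : blkAt ([h] :: [u] :: rest) (i + 2) =
          ([u] :: (rest ++ [[u]]))[i + 1]'(by simp; omega) := by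
        rw [blkAt, List.getD_eq_getElem _ _ (by simp; omega)]
        simp only [List.getElem_cons_succ]
        rw [List.getElem_append_left (by omega)]
      simp only [e1, e2]
      exact hh
  have hmem : ∀ i < g.n, blkAt ([h] :: [u] :: rest) i ∈ [h] :: [u] :: rest := by
    intro i hi
    rw [blkAt, List.getD_eq_getElem _ _ (by simp; omega)]
    exact List.getElem_mem _
  refine ⟨by simp [hn], hle, hlt, ?_, ?_, hneB, ?_, hsg, ?_, hf0, by rw [hjn]; exact hJ⟩
  · rw [List.flatten_cons, List.singleton_append, List.nodup_cons]
    refine ⟨?_, by simpa using h1⟩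
    intro hm
    exact (h2 h).1 (by simpa using hm) rfl
  · intro v
    by_cases hv : v = h
    · simp [hv]
    · have := (h2 v).2 hv
      simp only [List.flatten_cons, List.singleton_append]
      exact List.mem_cons_of_mem _ this
  · intro b hb'
    rcases List.mem_cons.1 hb' with rfl | hb'
    · simp
    · refine hb b ?_
      rcases List.mem_cons.1 hb' with rfl | hb'
      · simp
      · simp [hb']
  · intro p hp
    have hp' := hp
    rw [ht0, List.mem_append] at hp
    rcases hp with hp | hp
    · have hl := hlt p (List.mem_append_left _ hp')
      have n1 := hneB _ (hmem _ hl.1)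
      have n2 := hneB _ (hmem _ hl.2)
      refine ⟨_, List.getLast_mem n1, _, List.head_mem n2, hJ p hp _ ?_ _ ?_⟩
      · rw [List.getLast?_eq_getLast_of_ne_nil n1]; rfl
      · rw [List.head?_eq_some_head n2]; rfl
    · exact hhs p hp

theorem cfg3_lt {a b c : ℕ} (ha : a = 1 ∨ a = 2 ∨ a = 3) (hb : b = 1 ∨ b = 2 ∨ b = 3)
    (hc : c = 1 ∨ c = 2 ∨ c = 3) :
    ∀ p ∈ (cfg3 a b c).t0 ++ (cfg3 a b c).f0, p.1 < (cfg3 a b c).n ∧ p.2 < (cfg3 a b c).n := by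
  rcases ha with rfl | rfl | rfl <;> rcases hb with rfl | rfl | rfl <;>
    rcases hc with rfl | rfl | rfl <;> decide

theorem seg_split (S : List V) (hne : S ≠ []) : ∃ (s : ℕ) (seg : List (List V)),
    (s = 1 ∨ s = 2 ∨ s = 3) ∧ seg.flatten = S ∧ seg.length = s ∧ [] ∉ seg ∧
      ∀ i ∈ segSg 0 s, i < s ∧ ∃ x, seg.getD i [] = [x] := by
  match S, hne with
  | [a], _ => exact ⟨1, [[a]], by simp, by simp, rfl, by simp, by simp [segSg]⟩
  | [a, b], _ => exact ⟨2, [[a], [b]], by simp, by simp, rfl, by simp, by simp [segSg]⟩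
  | a :: b :: c :: t, _ =>
    rcases List.eq_nil_or_concat' (c :: t) with h | ⟨M, z, h⟩
    · simp at h
    · exact ⟨3, [[a], b :: M, [z]], by simp, by simp [h], rfl, by simp, by simp [segSg]⟩

theorem segSg_shift (k s i : ℕ) (h : i ∈ segSg k s) : ∃ j ∈ segSg 0 s, i = k + j := by
  unfold segSg at *
  split_ifs at * <;> simp at h ⊢ <;> omega

theorem blk_shift (pre seg post : List (List V)) (j : ℕ) (hj : j < seg.length) :
    blkAt (pre ++ (seg ++ post)) (pre.length + j) = seg.getD j [] := by
  rw [blkAt, List.getD_append_right _ _ _ _ (by omega), Nat.add_sub_cancel_left,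
    List.getD_append _ _ _ _ hj]

theorem blk_at (pre post : List (List V)) (b : List V) :
    blkAt (pre ++ (b :: post)) pre.length = b := by
  rw [blkAt, List.getD_append_right _ _ _ _ le_rfl]
  simp

theorem main3 (h3 : Conn3 G) (hfree : MinorFree K24 G) (hH : ¬ ∃ l, HamL G l)
    {h u₁ u₂ u₃ : V} {S₁ S₂ S₃ : List V}
    (hc : Near G h (u₁ :: (S₁ ++ u₂ :: (S₂ ++ u₃ :: S₃))))
    (n₁ : S₁ ≠ []) (n₂ : S₂ ≠ []) (n₃ : S₃ ≠ [])
    (a₁ : G.Adj h u₁) (a₂ : G.Adj h u₂) (a₃ : G.Adj h u₃)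
    (f₁ : ∀ x ∈ S₁, ¬ G.Adj h x) (f₂ : ∀ x ∈ S₂, ¬ G.Adj h x) (f₃ : ∀ x ∈ S₃, ¬ G.Adj h x) :
    False := by
  obtain ⟨a, A, ha, rfl, hla, hna, hsa⟩ := seg_split S₁ n₁
  obtain ⟨b, B, hb, rfl, hlb, hnb, hsb⟩ := seg_split S₂ n₂
  obtain ⟨c, C, hc', rfl, hlc, hnc, hsc⟩ := seg_split S₃ n₃
  have R : Realizes G (cfg3 a b c) ([h] :: [u₁] :: (A ++ [u₂] :: (B ++ [u₃] :: C))) := by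
    have b0 : blkAt ([h] :: [u₁] :: (A ++ [u₂] :: (B ++ [u₃] :: C))) 0 = [h] := rfl
    have b1 : blkAt ([h] :: [u₁] :: (A ++ [u₂] :: (B ++ [u₃] :: C))) 1 = [u₁] := rfl
    have b2 : blkAt ([h] :: [u₁] :: (A ++ [u₂] :: (B ++ [u₃] :: C))) (a + 2) = [u₂] := by
      have := blk_at ([h] :: [u₁] :: A) (B ++ [u₃] :: C) [u₂]
      simpa [hla] using this
    have b3 : blkAt ([h] :: [u₁] :: (A ++ [u₂] :: (B ++ [u₃] :: C))) (a + b + 3) = [u₃] := by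
      have := blk_at ([h] :: [u₁] :: (A ++ [u₂] :: B)) C [u₃]
      simp only [List.length_cons, List.length_append, hla, hlb] at this
      rw [show a + (b + 1) + 1 + 1 = a + b + 3 by ring] at this
      simpa using this
    have sA : ∀ j < a, blkAt ([h] :: [u₁] :: (A ++ [u₂] :: (B ++ [u₃] :: C))) (2 + j) =
        A.getD j [] := fun j hj =>
      blk_shift [[h], [u₁]] A ([u₂] :: (B ++ [u₃] :: C)) j (by omega)
    have sB : ∀ j < b, blkAt ([h] :: [u₁] :: (A ++ [u₂] :: (B ++ [u₃] :: C))) (a + 3 + j) =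
        B.getD j [] := by
      intro j hj
      have := blk_shift ([h] :: [u₁] :: (A ++ [[u₂]])) B ([u₃] :: C) j (by omega)
      simp only [List.length_cons, List.length_append, hla, List.length_nil] at this
      rw [show a + (0 + 1) + 1 + 1 + j = a + 3 + j by ring] at this
      rw [← this]; simp
    have sC : ∀ j < c, blkAt ([h] :: [u₁] :: (A ++ [u₂] :: (B ++ [u₃] :: C))) (a + b + 4 + j) =
        C.getD j [] := by
      intro j hj
      have := blk_shift ([h] :: [u₁] :: (A ++ [u₂] :: (B ++ [[u₃]]))) C [] j (by omega)
      simp only [List.length_cons, List.length_append, hla, hlb, List.length_nil] at this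
      rw [show a + (b + (0 + 1) + 1) + 1 + 1 + j = a + b + 4 + j by ring] at this
      rw [← this]; simp
    have hn : (cfg3 a b c).n = (A ++ [u₂] :: (B ++ [u₃] :: C)).length + 2 := by
      simp [cfg3, hla, hlb, hlc]; ring
    refine realize (g := cfg3 a b c) (hs := [(0, 1), (0, a + 2), (0, a + b + 3)]) ?_ ?_ hn ?_
      (cfg3_lt ha hb hc') rfl rfl ?_ ?_ ?_
    · simp [hna, hnb, hnc]
    · simpa using hc
    · show a + b + c + 4 ≤ 16
      omega
    · intro p hp
      simp only [List.mem_cons, List.not_mem_nil, or_false] at hp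
      rcases hp with rfl | rfl | rfl
      · exact ⟨h, by simp [b0], u₁, by simp [b1], a₁⟩
      · exact ⟨h, by simp [b0], u₂, by simp [b2], a₂⟩
      · exact ⟨h, by simp [b0], u₃, by simp [b3], a₃⟩
    · intro p hp
      simp only [cfg3, List.mem_map, List.mem_filter, List.mem_range] at hp
      obtain ⟨y, ⟨hy, hy'⟩, rfl⟩ := hp
      simp at hy'
      rintro ⟨x, hx, z, hz, hxz⟩
      simp only [b0, List.mem_singleton] at hx
      subst hx
      simp only at hz
      rcases Nat.lt_or_ge y (a + 2) with h1 | h1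
      · obtain ⟨j, rfl⟩ : ∃ j, y = 2 + j := ⟨y - 2, by omega⟩
        rw [sA j (by omega), List.getD_eq_getElem _ _ (by omega)] at hz
        exact f₁ z (List.mem_flatten.2 ⟨_, List.getElem_mem _, hz⟩) hxz
      rcases Nat.lt_or_ge y (a + b + 3) with h2 | h2
      · obtain ⟨j, rfl⟩ : ∃ j, y = a + 3 + j := ⟨y - (a + 3), by omega⟩
        rw [sB j (by omega), List.getD_eq_getElem _ _ (by omega)] at hz
        exact f₂ z (List.mem_flatten.2 ⟨_, List.getElem_mem _, hz⟩) hxz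
      · obtain ⟨j, rfl⟩ : ∃ j, y = a + b + 4 + j := ⟨y - (a + b + 4), by omega⟩
        rw [sC j (by omega), List.getD_eq_getElem _ _ (by omega)] at hz
        exact f₃ z (List.mem_flatten.2 ⟨_, List.getElem_mem _, hz⟩) hxz
    · intro i hi
      simp only [cfg3, List.mem_append, List.mem_cons, List.not_mem_nil, or_false] at hi
      rcases hi with ((((rfl | rfl | rfl | rfl)) | hi) | hi) | hi
      · exact ⟨_, b0⟩
      · exact ⟨_, b1⟩
      · exact ⟨_, b2⟩
      · exact ⟨_, b3⟩
      · obtain ⟨j, hj, rfl⟩ := segSg_shift _ _ _ hi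
        rw [sA j (hsa j hj).1]
        exact (hsa j hj).2
      · obtain ⟨j, hj, rfl⟩ := segSg_shift _ _ _ hi
        rw [sB j (hsb j hj).1]
        exact (hsb j hj).2
      · obtain ⟨j, hj, rfl⟩ := segSg_shift _ _ _ hi
        rw [sC j (hsc j hj).1]
        exact (hsc j hj).2
  clear hla hlb hlc hsa hsb hsc
  rcases ha with rfl | rfl | rfl <;> rcases hb with rfl | rfl | rfl <;>
    rcases hc' with rfl | rfl | rfl
  · exact sound R h3 hfree hH check3_111
  · exact sound R h3 hfree hH check3_112
  · exact sound R h3 hfree hH check3_113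
  · exact sound R h3 hfree hH check3_121
  · exact sound R h3 hfree hH check3_122
  · exact sound R h3 hfree hH check3_123
  · exact sound R h3 hfree hH check3_131
  · exact sound R h3 hfree hH check3_132
  · exact sound R h3 hfree hH check3_133
  · exact sound R h3 hfree hH check3_211
  · exact sound R h3 hfree hH check3_212
  · exact sound R h3 hfree hH check3_213
  · exact sound R h3 hfree hH check3_221
  · exact sound R h3 hfree hH check3_222
  · exact sound R h3 hfree hH check3_223
  · exact sound R h3 hfree hH check3_231
  · exact sound R h3 hfree hH check3_232
  · exact sound R h3 hfree hH check3_233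
  · exact sound R h3 hfree hH check3_311
  · exact sound R h3 hfree hH check3_312
  · exact sound R h3 hfree hH check3_313
  · exact sound R h3 hfree hH check3_321
  · exact sound R h3 hfree hH check3_322
  · exact sound R h3 hfree hH check3_323
  · exact sound R h3 hfree hH check3_331
  · exact sound R h3 hfree hH check3_332
  · exact sound R h3 hfree hH check3_333

theorem main4 (h3 : Conn3 G) (hfree : MinorFree K24 G) (hH : ¬ ∃ l, HamL G l)
    {h u₁ u₂ u₃ u₄ : V} {S₁ S₂ S₃ S₄ : List V}
    (hc : Near G h (u₁ :: (S₁ ++ u₂ :: (S₂ ++ u₃ :: (S₃ ++ u₄ :: S₄)))))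
    (n₁ : S₁ ≠ []) (n₂ : S₂ ≠ []) (n₃ : S₃ ≠ []) (n₄ : S₄ ≠ [])
    (a₁ : G.Adj h u₁) (a₂ : G.Adj h u₂) (a₃ : G.Adj h u₃) (a₄ : G.Adj h u₄)
    (f₁ : ∀ x ∈ S₁, ¬ G.Adj h x) (f₂ : ∀ x ∈ S₂, ¬ G.Adj h x) (f₃ : ∀ x ∈ S₃, ¬ G.Adj h x) :
    False := by
  refine sound (g := cfg4) (bl := [h] :: [u₁] :: [S₁, [u₂], S₂, [u₃], S₃, [u₄], S₄])
    (realize (hs := [(0, 1), (0, 3), (0, 5), (0, 7)]) ?_ ?_ rfl (by decide) (by decide) rfl rfl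
      ?_ ?_ ?_) h3 hfree hH check4_true
  · simp [n₁.symm, n₂.symm, n₃.symm, n₄.symm]
  · simpa using hc
  · simp [EE, blkAt, a₁, a₂, a₃, a₄]
  · simp [EE, blkAt, cfg4]
    exact ⟨f₁, f₂, f₃⟩
  · simp [blkAt, cfg4]

theorem near_false [Finite V] (h3 : Conn3 G) (hfree : MinorFree K24 G) (hH : ¬ ∃ l, HamL G l)
    {h : V} {c : List V} (hc : Near G h c) : False := by
  obtain ⟨a, ha⟩ := exists_ne_of_conn3 h3 h
  obtain ⟨u₁, a₁, -⟩ := exists_nbr h3 ha ha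
  obtain ⟨p, q, rfl⟩ := List.append_of_mem ((hc.2.1 u₁).2 a₁.ne')
  have hc' : Near G h (u₁ :: (q ++ p)) := hc.rot List.isRotated_append
  clear hc
  generalize q ++ p = t at hc'
  obtain ⟨v, av, hv, -⟩ := exists_nbr h3 a₁.ne' a₁.ne'
  have hvt : v ∈ t := (List.mem_cons.1 ((hc'.2.1 v).2 av.ne')).resolve_left hv
  obtain ⟨S₁, u₂, t₂, rfl, f₁, a₂⟩ := split_first (G.Adj h) t ⟨v, hvt, av⟩
  clear hvt hv av v
  obtain ⟨v, av, hv1, hv2⟩ := exists_nbr h3 a₁.ne' a₂.ne'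
  have hvt : v ∈ t₂ := by
    have hm := (hc'.2.1 v).2 av.ne'
    simp only [List.mem_cons, List.mem_append, hv1, hv2, false_or] at hm
    exact hm.resolve_left fun hm => f₁ v hm av
  obtain ⟨S₂, u₃, t₃, rfl, f₂, a₃⟩ := split_first (G.Adj h) t₂ ⟨v, hvt, av⟩
  have n₁ : S₁ ≠ [] := by
    rintro rfl
    exact Near.no_consec hH (hc'.rot (c' := u₂ :: (S₂ ++ u₃ :: t₃) ++ [u₁])
      (List.isRotated_append (l := [u₁]))) a₁ a₂
  have n₂ : S₂ ≠ [] := by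
    rintro rfl
    refine Near.no_consec hH (hc'.rot (c' := u₃ :: (t₃ ++ u₁ :: S₁) ++ [u₂]) ?_) a₂ a₃
    have := List.isRotated_append (l := u₁ :: S₁ ++ [u₂]) (l' := u₃ :: t₃)
    simpa using this
  by_cases h4 : ∃ x ∈ t₃, G.Adj h x
  · obtain ⟨S₃, u₄, S₄, rfl, f₃, a₄⟩ := split_first (G.Adj h) t₃ h4
    have n₃ : S₃ ≠ [] := by
      rintro rfl
      refine Near.no_consec hH (hc'.rot (c' := u₄ :: (S₄ ++ u₁ :: (S₁ ++ u₂ :: S₂)) ++ [u₃]) ?_)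
        a₃ a₄
      have := List.isRotated_append (l := u₁ :: (S₁ ++ u₂ :: (S₂ ++ [u₃]))) (l' := u₄ :: S₄)
      simpa using this
    have n₄ : S₄ ≠ [] := by
      rintro rfl
      refine Near.no_consec hH (b := u₁) (Q := S₁ ++ u₂ :: (S₂ ++ u₃ :: S₃)) (a := u₄) ?_ a₄ a₁
      simpa using hc'
    exact main4 h3 hfree hH hc' n₁ n₂ n₃ n₄ a₁ a₂ a₃ a₄ f₁ f₂ f₃
  · have n₃ : t₃ ≠ [] := by
      rintro rfl
      refine Near.no_consec hH (b := u₁) (Q := S₁ ++ u₂ :: S₂) (a := u₃) ?_ a₃ a₁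
      simpa using hc'
    exact main3 h3 hfree hH hc' n₁ n₂ n₃ a₁ a₂ a₃ f₁ f₂ fun x hx hax => h4 ⟨x, hx, hax⟩

end Near

/-! ### The induction -/

section Final

theorem complete_of_card_four {V : Type*} [Finite V] {G : SimpleGraph V} (h3 : Conn3 G)
    (h4 : Nat.card V = 4) {p q : V} (hpq : p ≠ q) : G.Adj p q := by
  have h1 := Set.ncard_add_ncard_compl ({p, q} : Set V)
  rw [Set.ncard_pair hpq, h4] at h1
  have h2 : (({p, q} : Set V)ᶜ).ncard = 2 := by omega
  obtain ⟨r, s, -, hrs⟩ := Set.ncard_eq_two.1 h2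
  have hr : r ∈ ({p, q} : Set V)ᶜ := by rw [hrs]; simp
  have hs : s ∈ ({p, q} : Set V)ᶜ := by rw [hrs]; simp
  simp only [Set.mem_compl_iff, Set.mem_insert_iff, Set.mem_singleton_iff, not_or] at hr hs
  obtain ⟨c, hc, hcr, hcs⟩ := exists_nbr h3 hr.1 hs.1
  have : c ∉ ({p, q} : Set V)ᶜ := by
    rw [hrs]
    simp [hcr, hcs]
  simp only [Set.mem_compl_iff, Set.mem_insert_iff, Set.mem_singleton_iff, not_not] at this
  rcases this with rfl | rfl
  · exact absurd rfl hc.ne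
  · exact hc

theorem ham_of_card_four {V : Type*} [Finite V] {G : SimpleGraph V} (h3 : Conn3 G)
    (h4 : Nat.card V = 4) : ∃ l, HamL G l := by
  have := Fintype.ofFinite V
  have hlen : (Finset.univ : Finset V).toList.length = 4 := by
    rw [Finset.length_toList, Finset.card_univ, ← Nat.card_eq_fintype_card, h4]
  have hnd := Finset.nodup_toList (Finset.univ : Finset V)
  have hmem : ∀ v : V, v ∈ (Finset.univ : Finset V).toList := by simp
  generalize (Finset.univ : Finset V).toList = l at *
  match l, hlen with
  | [a, b, c, d], _ =>
    refine ⟨_, hnd, hmem, ?_⟩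
    rw [Cycle.chain_coe_cons]
    simp only [List.nodup_cons, List.mem_cons, List.not_mem_nil, not_or] at hnd
    have key := fun p q (h : p ≠ q) => complete_of_card_four h3 h4 h
    simp only [List.cons_append, List.nil_append, List.isChain_cons_cons]
    exact ⟨key _ _ hnd.1.1, key _ _ hnd.2.1.1, key _ _ hnd.2.2.1.1, key _ _ (Ne.symm hnd.1.2.2.1),
      by simp⟩

theorem chain_snoc {V : Type*} {G : SimpleGraph V} {a b q : V} {M : List V}
    (h : (a :: (M ++ [b])).IsChain G.Adj) (hb : G.Adj b q) :
    (a :: (M ++ [b]) ++ [q]).IsChain G.Adj := by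
  rw [List.isChain_append]
  refine ⟨h, by simp, ?_⟩
  intro x hx y hy
  rw [← List.cons_append, List.getLast?_append] at hx
  simp at hx hy
  subst hx hy
  exact hb

theorem ham_of_conn3.{u} (n : ℕ) : ∀ {V : Type u} [Finite V] (G : SimpleGraph V), Nat.card V = n →
    Conn3 G → MinorFree K24 G → ∃ l, HamL G l := by
  induction n with
  | zero =>
    intro V _ G hn h3 _
    have := h3.1
    omega
  | succ n ih =>
    intro V _ G hn h3 hfree
    by_cases h4 : n = 3
    · exact ham_of_card_four h3 (by omega)
    have h5 : 5 ≤ Nat.card V := by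
      have := h3.1
      omega
    obtain ⟨x, y, hxy, hc3⟩ := exists_contraction h3 h5
    have hcard : Nat.card {v // v ≠ y} = n := by
      have h1 : Nat.card {v // v ≠ y} = ({y}ᶜ : Set V).ncard := Nat.card_coe_set_eq _
      have h2 := Set.ncard_add_ncard_compl ({y} : Set V)
      rw [Set.ncard_singleton] at h2
      omega
    obtain ⟨l, hl1, hl2, hl3⟩ := ih (ctr G x y) hcard hc3 (minorFree_ctr hxy hfree)
    obtain ⟨p, q, rfl⟩ := List.append_of_mem (hl2 ⟨x, hxy.ne⟩)
    have hr : (p ++ ⟨x, hxy.ne⟩ :: q) ~r (⟨x, hxy.ne⟩ :: (q ++ p)) := List.isRotated_append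
    rw [hr.nodup_iff] at hl1
    rw [Cycle.coe_eq_coe.2 hr] at hl3
    simp only [hr.mem_iff] at hl2
    clear hr
    generalize q ++ p = t at hl1 hl2 hl3
    rw [List.nodup_cons] at hl1
    obtain ⟨hxt, hnd⟩ := hl1
    rw [Cycle.chain_coe_cons] at hl3
    obtain ⟨z, hz⟩ := exists_ne_of_conn3 hc3 ⟨x, hxy.ne⟩
    obtain ⟨z', -, hz', hzz⟩ := exists_nbr hc3 hz hz
    obtain ⟨z1, hz1x, hz1, -⟩ := exists_nbr hc3 hz hz
    have tz : z ∈ t := (List.mem_cons.1 (hl2 z)).resolve_left hz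
    have tz1 : z1 ∈ t := (List.mem_cons.1 (hl2 z1)).resolve_left hz1x.ne'
    obtain ⟨a, M, b, rfl⟩ : ∃ a M b, t = a :: (M ++ [b]) := by
      match t, tz, tz1 with
      | [c], h1, h2 =>
        simp only [List.mem_singleton] at h1 h2
        exact absurd (h2.trans h1.symm) hz1
      | a :: c :: t, _, _ =>
        rcases List.eq_nil_or_concat' (c :: t) with h | ⟨M, w, h⟩
        · simp at h
        · exact ⟨a, M, w, by rw [h]⟩
    have hne : ∀ v ∈ a :: (M ++ [b]), v.1 ≠ x := by
      intro v hv h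
      have : v = ⟨x, hxy.ne⟩ := Subtype.ext h
      rw [this] at hv
      exact hxt hv
    have hax := hne a (by simp)
    have hbx := hne b (by simp)
    rw [List.cons_append, List.isChain_cons_cons] at hl3
    obtain ⟨hxa, hl4⟩ := hl3
    have e1 : a :: (M ++ [b] ++ [⟨x, hxy.ne⟩]) = (a :: (M ++ [b])) ++ [⟨x, hxy.ne⟩] := by simp
    rw [e1, List.isChain_append] at hl4
    obtain ⟨hch, -, hbx'⟩ := hl4
    have hbx2 : (ctr G x y).Adj b ⟨x, hxy.ne⟩ := by
      refine hbx' b ?_ _ (by simp)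
      rw [← List.cons_append, List.getLast?_append]
      simp
    have hchG : (a.1 :: (M.map Subtype.val ++ [b.1])).IsChain G.Adj := by
      have e2 : a.1 :: (M.map Subtype.val ++ [b.1]) = (a :: (M ++ [b])).map Subtype.val := by simp
      rw [e2, List.isChain_map]
      refine hch.imp_of_mem_imp ?_
      rintro u w hu hw ⟨-, h | h | h⟩
      · exact h
      · exact absurd h.1 (hne u hu)
      · exact absurd h.1 (hne w hw)
    have hndG : (a.1 :: (M.map Subtype.val ++ [b.1])).Nodup := by
      have e2 : a.1 :: (M.map Subtype.val ++ [b.1]) = (a :: (M ++ [b])).map Subtype.val := by simp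
      rw [e2]
      exact hnd.map Subtype.val_injective
    have hmemG : ∀ v, v ∈ a.1 :: (M.map Subtype.val ++ [b.1]) ↔ v ≠ x ∧ v ≠ y := by
      have e2 : a.1 :: (M.map Subtype.val ++ [b.1]) = (a :: (M ++ [b])).map Subtype.val := by simp
      intro v
      rw [e2, List.mem_map]
      constructor
      · rintro ⟨u, hu, rfl⟩
        exact ⟨hne u hu, u.2⟩
      · rintro ⟨h1, h2⟩
        refine ⟨⟨v, h2⟩, (List.mem_cons.1 (hl2 ⟨v, h2⟩)).resolve_left ?_, rfl⟩
        exact fun h => h1 (congrArg Subtype.val h)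
    have hA : G.Adj x a ∨ G.Adj y a := by
      rcases hxa.2 with h | h | h
      · exact Or.inl h
      · exact Or.inr h.2
      · exact absurd h.1 hax
    have hB : G.Adj b x ∨ G.Adj b y := by
      rcases hbx2.2 with h | h | h
      · exact Or.inl h
      · exact absurd h.1 hbx
      · exact Or.inr h.2
    clear hl2 hnd hch hbx2 hxa hxt hne hbx' e1 hz tz tz1 hz1x hz1 hz' hzz
    generalize M.map Subtype.val = N at *
    generalize a.1 = a' at *
    generalize b.1 = b' at *
    by_contra hH
    have hamcase : ∀ p q, (∀ v, v ∈ a' :: (N ++ [b']) ↔ v ≠ p ∧ v ≠ q) → G.Adj p q →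
        G.Adj p a' → G.Adj b' q → False := by
      intro p q hm hpq hpa hbq
      refine hH ⟨p :: (a' :: (N ++ [b']) ++ [q]), ?_, ?_, ?_⟩
      · rw [List.nodup_cons, List.nodup_append']
        refine ⟨?_, hndG, by simp, ?_⟩
        · intro h
          rcases List.mem_append.1 h with h | h
          · exact ((hm p).1 h).1 rfl
          · exact hpq.ne (List.mem_singleton.1 h)
        · intro v hv hv'
          rw [List.mem_singleton] at hv'
          exact ((hm v).1 hv).2 hv'
      · intro v
        by_cases h1 : v = p
        · simp [h1]
        by_cases h2 : v = q
        · simp [h2]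
        exact List.mem_cons_of_mem _ (List.mem_append_left _ ((hm v).2 ⟨h1, h2⟩))
      · rw [Cycle.chain_coe_cons]
        have := chain_snoc (chain_snoc hchG hbq) hpq.symm
        rw [List.cons_append, List.cons_append, List.isChain_cons_cons]
        exact ⟨hpa, this⟩
    have nearcase : ∀ p q, (∀ v, v ∈ a' :: (N ++ [b']) ↔ v ≠ p ∧ v ≠ q) → G.Adj p q →
        G.Adj p a' → G.Adj b' p → False := by
      intro p q hm hpq hpa hbp
      refine near_false h3 hfree hH (h := q) (c := p :: (a' :: (N ++ [b']))) ⟨?_, ?_, ?_⟩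
      · rw [List.nodup_cons]
        exact ⟨fun h => ((hm p).1 h).1 rfl, hndG⟩
      · intro v
        rw [List.mem_cons, hm v]
        constructor
        · rintro (rfl | h)
          · exact hpq.ne
          · exact h.2
        · intro h
          by_cases h1 : v = p
          · exact Or.inl h1
          · exact Or.inr ⟨h1, h⟩
      · rw [Cycle.chain_coe_cons, List.cons_append, List.isChain_cons_cons]
        exact ⟨hpa, chain_snoc hchG hbp⟩
    have hmemG' : ∀ v, v ∈ a' :: (N ++ [b']) ↔ v ≠ y ∧ v ≠ x := fun v => by
      rw [hmemG v, and_comm]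
    rcases hA with hA | hA <;> rcases hB with hB | hB
    · exact nearcase x y hmemG hxy hA hB
    · exact hamcase x y hmemG hxy hA hB
    · exact hamcase y x hmemG' hxy.symm hA hB
    · exact nearcase y x hmemG' hxy.symm hA hB

theorem walk_of_chain {V : Type*} {G : SimpleGraph V} (a : V) : ∀ (l : List V) (b : V),
    (b :: (l ++ [a])).IsChain G.Adj → ∃ w : G.Walk b a, w.support = b :: (l ++ [a]) := by
  intro l
  induction l with
  | nil =>
    intro b h
    simp only [List.nil_append, List.isChain_cons_cons] at h
    exact ⟨SimpleGraph.Walk.cons h.1 SimpleGraph.Walk.nil, by simp⟩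
  | cons c l ih =>
    intro b h
    rw [List.cons_append, List.isChain_cons_cons] at h
    obtain ⟨w, hw⟩ := ih c h.2
    exact ⟨SimpleGraph.Walk.cons h.1 w, by simp [hw]⟩

theorem walk_of_hamL {V : Type*} [Fintype V] [DecidableEq V] {G : SimpleGraph V}
    (h4 : 4 ≤ Nat.card V) {l : List V} (hl : HamL G l) :
    ∃ (v : V) (p : G.Walk v v), p.IsHamiltonianCycle := by
  obtain ⟨h1, h2, h3⟩ := hl
  have hlen : 4 ≤ l.length := by
    rw [Nat.card_eq_fintype_card] at h4
    refine h4.trans ?_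
    rw [← Finset.card_univ, ← List.toFinset_card_of_nodup h1]
    exact Finset.card_le_card fun v _ => List.mem_toFinset.2 (h2 v)
  match l, hlen with
  | a :: b :: c :: d :: t, _ =>
    rw [Cycle.chain_coe_cons] at h3
    simp only [List.cons_append, List.isChain_cons_cons] at h3
    obtain ⟨hab, hbc, hcd, h3⟩ := h3
    obtain ⟨w, hw⟩ := walk_of_chain a t d h3
    have hperm : (b :: c :: d :: (t ++ [a])).Perm (a :: b :: c :: d :: t) :=
      List.perm_append_singleton a (b :: c :: d :: t)
    have hsup : (SimpleGraph.Walk.cons hbc (SimpleGraph.Walk.cons hcd w)).support =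
        b :: c :: d :: (t ++ [a]) := by simp [hw]
    have hpath : (SimpleGraph.Walk.cons hbc (SimpleGraph.Walk.cons hcd w)).IsPath := by
      rw [SimpleGraph.Walk.isPath_def, hsup, hperm.nodup_iff]
      exact h1
    refine ⟨a, SimpleGraph.Walk.cons hab (SimpleGraph.Walk.cons hbc (SimpleGraph.Walk.cons hcd w)),
      ?_, ?_⟩
    · rw [SimpleGraph.Walk.cons_isCycle_iff]
      refine ⟨hpath, ?_⟩
      rw [SimpleGraph.Walk.edges_cons, List.mem_cons]
      rintro (h | h)
      · rw [Sym2.eq_iff] at h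
        simp only [List.nodup_cons, List.mem_cons, not_or] at h1
        rcases h with h | h
        · exact hab.ne h.1
        · exact h1.1.2.1 h.1
      · have hm := SimpleGraph.Walk.snd_mem_support_of_mem_edges _ h
        rw [SimpleGraph.Walk.cons_isPath_iff] at hpath
        exact hpath.2 hm
    · have := hpath.isHamiltonian_of_mem fun v => by
        rw [hsup, hperm.mem_iff]; exact h2 v
      intro v
      rw [SimpleGraph.Walk.support_tail_of_not_nil _ (by simp)]
      exact this v

end Final

end K24Paper

namespace K24Paper

open SimpleGraph

/-- Corollary 21(i): every 3-connected `K_{2,4}`-minor-free graph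
has a hamilton cycle. -/
theorem threeConnected_K24MinorFree_hamiltonian {V : Type*} [Fintype V]
    [DecidableEq V] (G : SimpleGraph V) (h3 : KConnected 3 G)
    (hfree : MinorFree K24 G) :
    ∃ (v : V) (p : G.Walk v v), p.IsHamiltonianCycle := by
  have h3' := conn3_of_KConnected h3
  obtain ⟨l, hl⟩ := ham_of_conn3 _ G rfl h3' hfree
  exact walk_of_hamL h3'.1 hl

end K24Paper
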